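/- arXiv:2212.14251 — 2 statements merged into one kernel-verified Lean document; each statement's English description precedes it below -/
import Mathlib

section
/- Let d ≥ 4, n ≥ 1, and u ∈ ℝ^d with u ≠ 0. Let μ_n be the probability measure on (ℝ^d)^n with density ∏_{j=1}^n p^d_{1/n}(x_j − x_{j−1}) (with x₀ = 0) with respect to Lebesgue measure, and let θ̃_{u,n} be the probability measure on (ℝ^d)^n with density q_{u,n}/m(u,d) with respect to μ_n, where q_{u,n}(x₁,…,x_n) = ∫_{Δ₂} p^d_{σ²(s,t)}(n ∑_{j=1}^n α_j(s,t)(x_j − x_{j−1}) − u) ds dt and m(u,d) = ∫_{Δ₂} p^d_{t−s}(u) ds dt. Then the quadratic Wasserstein distance satisfies W₂²(θ̃_{u,n}, μ_n) ≤ (2/κ_n) · ( −log(2 m(u,d) (2π)^{d/2}) − (d/(2 m(u,d))) ∫_{Δ₂} log(σ²(s,t)) p^d_{t−s}(u) ds dt ), where κ_n = 2n(1 − cos(π/(2n+1))); equivalently, there exists a probability measure π on (ℝ^d)^n × (ℝ^d)^n with first marginal θ̃_{u,n} and second marginal μ_n such that ∫ ‖x − y‖² π(dx, dy) is at most the right-hand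 side. -/
open MeasureTheory Real

/-- The `d`-dimensional Gaussian density with variance parameter `ε`. -/
noncomputable def gaussD (d : ℕ) (ε : ℝ) (z : EuclideanSpace ℝ (Fin d)) : ℝ :=
  (2 * Real.pi * ε) ^ (-(d : ℝ) / 2) * Real.exp (-‖z‖ ^ 2 / (2 * ε))

/-- The simplex `Δ₂ = {(s,t) ∈ [0,1]² : s < t}`. -/
def Delta2 : Set (ℝ × ℝ) := {p | 0 ≤ p.1 ∧ p.1 < p.2 ∧ p.2 ≤ 1}

/-- `α_j(s,t) = λ([s,t] ∩ [t_{j-1},t_j])` where `t_j = j/n`. -/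
noncomputable def alphaJ (n : ℕ) (s t : ℝ) (j : Fin n) : ℝ :=
  (volume (Set.Icc s t ∩ Set.Icc ((j : ℝ) / n) (((j : ℝ) + 1) / n))).toReal

/-- `σ²(s,t) = (t - s) - n ∑_j α_j(s,t)²`. -/
noncomputable def sigma2 (n : ℕ) (s t : ℝ) : ℝ :=
  (t - s) - n * ∑ j : Fin n, alphaJ n s t j ^ 2

/-- The increment `x_j - x_{j-1}`, with the convention `x₀ = 0`. -/
noncomputable def padDiff {n d : ℕ} (x : Fin n → EuclideanSpace ℝ (Fin d)) (j : Fin n) :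
    EuclideanSpace ℝ (Fin d) :=
  (Fin.cons 0 x : Fin (n + 1) → EuclideanSpace ℝ (Fin d)) j.succ -
    (Fin.cons 0 x : Fin (n + 1) → EuclideanSpace ℝ (Fin d)) j.castSucc

/-- The law `μ_n` of `(W(1/n),…,W(1))`: the measure on `(ℝ^d)^n` with density
`∏_j p^d_{1/n}(x_j - x_{j-1})` with respect to Lebesgue measure. -/
noncomputable def muN (d n : ℕ) : Measure (Fin n → EuclideanSpace ℝ (Fin d)) :=
  volume.withDensity fun x => ENNReal.ofReal (∏ j : Fin n, gaussD d (1 / n) (padDiff x j))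

/-- The density `q_{u,n}` of the finite-dimensional marginal `θ_{u,n}` with respect to `μ_n`. -/
noncomputable def qUN (d n : ℕ) (u : EuclideanSpace ℝ (Fin d))
    (x : Fin n → EuclideanSpace ℝ (Fin d)) : ℝ :=
  ∫ p in Delta2,
    gaussD d (sigma2 n p.1 p.2) ((n : ℝ) • ∑ j : Fin n, alphaJ n p.1 p.2 j • padDiff x j - u)

/-- `m(u,d) = ∫_{Δ₂} p^d_{t-s}(u) ds dt`, the total mass of `θ_{u,n}`. -/
noncomputable def mUD (d : ℕ) (u : EuclideanSpace ℝ (Fin d)) : ℝ :=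
  ∫ p in Delta2, gaussD d (p.2 - p.1) u

/-- The normalized measure `θ̃_{u,n}`, with density `q_{u,n}/m(u,d)` with respect to `μ_n`. -/
noncomputable def thetaTilde (d n : ℕ) (u : EuclideanSpace ℝ (Fin d)) :
    Measure (Fin n → EuclideanSpace ℝ (Fin d)) :=
  (muN d n).withDensity fun x => ENNReal.ofReal (qUN d n u x / mUD d u)

section

variable {n d : ℕ}

/-- The discrete Wirtinger inequality for sequences vanishing at one end. -/
lemma discrete_wirtinger (n : ℕ) (c : ℕ → ℝ) (hc : c 0 = 0) :
    2 * (1 - cos (π / (2 * n + 1))) * ∑ j ∈ Finset.range n, c (j + 1) ^ 2 ≤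
      ∑ j ∈ Finset.range n, (c (j + 1) - c j) ^ 2 := by
  set h : ℝ := π / (2 * n + 1) with hh
  have hπ := pi_pos
  have hpos : ∀ k : ℕ, 1 ≤ k → k ≤ n → 0 < sin (k * h) := by
    intro k hk hkn
    have hk' : (1 : ℝ) ≤ k := by exact_mod_cast hk
    have hkn' : (k : ℝ) ≤ n := by exact_mod_cast hkn
    apply sin_pos_of_pos_of_lt_pi
    · rw [hh]; positivity
    · rw [hh, mul_div_assoc', div_lt_iff₀ (by positivity)]; nlinarith
  have key : ∀ k : ℕ, k ≤ n →
      2 * (1 - cos h) * ∑ j ∈ Finset.range k, c (j + 1) ^ 2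
        + (sin ((k + 1 : ℕ) * h) / sin (k * h) - 1) * c k ^ 2 ≤
      ∑ j ∈ Finset.range k, (c (j + 1) - c j) ^ 2 := by
    intro k
    induction k with
    | zero => intro _; simp [hc]
    | succ k ih =>
      intro hk
      have ih' := ih (by omega)
      rw [Finset.sum_range_succ, Finset.sum_range_succ]
      have hp1 := hpos (k + 1) (by omega) hk
      have hrec : sin ((k + 1 + 1 : ℕ) * h) = 2 * cos h * sin ((k + 1 : ℕ) * h) - sin (k * h) := by
        have e1 : ((k + 1 + 1 : ℕ) : ℝ) * h = (k + 1 : ℕ) * h + h := by push_cast; ring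
        have e2 : (k : ℝ) * h = (k + 1 : ℕ) * h - h := by push_cast; ring
        rw [e1, e2, sin_add, sin_sub]; ring
      rw [hrec]
      have hstep : 2 * (1 - cos h) * c (k + 1) ^ 2 +
          ((2 * cos h * sin ((k + 1 : ℕ) * h) - sin (k * h)) / sin ((k + 1 : ℕ) * h) - 1)
            * c (k + 1) ^ 2 ≤ (c (k + 1) - c k) ^ 2 +
          (sin ((k + 1 : ℕ) * h) / sin (k * h) - 1) * c k ^ 2 := by
        generalize sin ((k + 1 : ℕ) * h) = b at *
        have e : 2 * (1 - cos h) * c (k + 1) ^ 2 +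
          ((2 * cos h * b - sin (k * h)) / b - 1) * c (k + 1) ^ 2
            = c (k + 1) ^ 2 - sin (k * h) / b * c (k + 1) ^ 2 := by
          field_simp; ring
        rw [e]
        rcases Nat.eq_zero_or_pos k with rfl | hk0
        · simp [hc]
        · have ha := hpos k hk0 (by omega)
          generalize sin (k * h) = a at *
          have : 0 ≤ (b * c k - a * c (k + 1)) ^ 2 / (a * b) := by positivity
          have e2 : (c (k + 1) - c k) ^ 2 + (b / a - 1) * c k ^ 2
            - (c (k + 1) ^ 2 - a / b * c (k + 1) ^ 2)
              = (b * c k - a * c (k + 1)) ^ 2 / (a * b) := by field_simp; ring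
          linarith
      linarith
  rcases Nat.eq_zero_or_pos n with rfl | hn
  · simp
  have hlast : sin ((n + 1 : ℕ) * h) = sin (n * h) := by
    have : ((n + 1 : ℕ) : ℝ) * h = π - n * h := by
      rw [hh]; push_cast; field_simp; ring
    rw [this, sin_pi_sub]
  have := key n le_rfl
  rw [hlast, div_self (hpos n hn le_rfl).ne'] at this
  simpa using this

lemma one_sub_sqrt_sq_le_neg_log {r : ℝ} (hr : 0 < r) (hr1 : r ≤ 1) :
    (1 - √r) ^ 2 ≤ -log r := by
  have hs : 0 < √r := sqrt_pos.2 hr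
  have hs1 : √r ≤ 1 := sqrt_le_one.2 hr1
  have h1 := log_le_sub_one_of_pos hs
  rw [log_sqrt hr.le] at h1
  nlinarith

/-- `α_j` as the increment of the projection onto `[s,t]`. -/
lemma alphaJ_eq (n : ℕ) {s t : ℝ} (hst : s ≤ t) (j : Fin n) :
    alphaJ n s t j = max s (min t (((j : ℝ) + 1) / n)) - max s (min t ((j : ℝ) / n)) := by
  have hle : (j : ℝ) / n ≤ ((j : ℝ) + 1) / n := by gcongr; linarith
  unfold alphaJ
  rw [Set.Icc_inter_Icc, Real.volume_Icc]
  generalize (j : ℝ) / n = a at *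
  generalize ((j : ℝ) + 1) / n = b at *
  by_cases h : max s a ≤ min t b
  · rw [ENNReal.toReal_ofReal (by simpa using h)]
    grind
  · rw [ENNReal.ofReal_of_nonpos (by simpa using (not_le.1 h).le)]
    simp
    grind

lemma alphaJ_nonneg (n : ℕ) (s t : ℝ) (j : Fin n) : 0 ≤ alphaJ n s t j :=
  ENNReal.toReal_nonneg

lemma alphaJ_le (n : ℕ) {s t : ℝ} (hst : s ≤ t) (j : Fin n) : alphaJ n s t j ≤ 1 / n := by
  have hle : (j : ℝ) / n ≤ ((j : ℝ) + 1) / n := by gcongr; linarith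
  have : 1 / (n : ℝ) = ((j : ℝ) + 1) / n - (j : ℝ) / n := by ring
  rw [alphaJ_eq n hst, this]
  generalize (j : ℝ) / n = a at *
  generalize ((j : ℝ) + 1) / n = b at *
  grind

lemma sum_alphaJ {n : ℕ} (hn : 1 ≤ n) {p : ℝ × ℝ} (hp : p ∈ Delta2) :
    ∑ j, alphaJ n p.1 p.2 j = p.2 - p.1 := by
  obtain ⟨h0, h1, h2⟩ := hp
  have hn' : (n : ℝ) ≠ 0 := by positivity
  have := Finset.sum_range_sub (fun j : ℕ => max p.1 (min p.2 ((j : ℝ) / n))) n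
  simp only [alphaJ_eq n h1.le]
  rw [Fin.sum_univ_eq_sum_range
    (fun j : ℕ => max p.1 (min p.2 (((j : ℝ) + 1) / n)) - max p.1 (min p.2 ((j : ℝ) / n)))]
  push_cast at this
  rw [this, div_self hn']
  simp [h2, h1.le, h0.trans h1.le, h0]

lemma sigma2_eq {n : ℕ} (hn : 1 ≤ n) {p : ℝ × ℝ} (hp : p ∈ Delta2) :
    sigma2 n p.1 p.2 = ∑ j, alphaJ n p.1 p.2 j * (1 - n * alphaJ n p.1 p.2 j) := by
  rw [sigma2, ← sum_alphaJ hn hp, Finset.mul_sum, ← Finset.sum_sub_distrib]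
  exact Finset.sum_congr rfl fun j _ => by ring

lemma sum_alphaJ_sq_pos {n : ℕ} (hn : 1 ≤ n) {p : ℝ × ℝ} (hp : p ∈ Delta2) :
    0 < n * ∑ j, alphaJ n p.1 p.2 j ^ 2 := by
  have hn' : (0 : ℝ) < n := by positivity
  refine mul_pos hn' (lt_of_le_of_ne (Finset.sum_nonneg fun _ _ => sq_nonneg _) fun h => ?_)
  have h0 := (Finset.sum_eq_zero_iff_of_nonneg fun j _ => sq_nonneg (alphaJ n p.1 p.2 j)).1 h.symm
  have h1 := sum_alphaJ hn hp
  rw [Finset.sum_eq_zero fun j hj => by simpa using h0 j hj] at h1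
  linarith [hp.2.1]

lemma sigma2_le {n : ℕ} (p : ℝ × ℝ) : sigma2 n p.1 p.2 ≤ p.2 - p.1 := by
  have : 0 ≤ (n : ℝ) * ∑ j, alphaJ n p.1 p.2 j ^ 2 := by positivity
  unfold sigma2; linarith

lemma sigma2_lower {n : ℕ} (hn : 1 ≤ n) {p : ℝ × ℝ} (hp : p ∈ Delta2) :
    ∃ i < n, 0 ≤ p.1 - (i : ℝ) / n ∧ p.1 - (i : ℝ) / n ≤ 1 ∧
      0 ≤ ((i + 1 : ℕ) : ℝ) / n - p.1 ∧ ((i + 1 : ℕ) : ℝ) / n - p.1 ≤ 1 ∧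
      (p.2 - p.1) * ((((i + 1 : ℕ) : ℝ) / n - p.1) * (p.1 - (i : ℝ) / n)) ≤ sigma2 n p.1 p.2 := by
  have hn' : (0 : ℝ) < n := by positivity
  have hn1 : (1 : ℝ) ≤ n := by exact_mod_cast hn
  rw [sigma2_eq hn hp]
  obtain ⟨h0, h1, h2⟩ := hp
  have hpn : 0 ≤ p.1 * n := by positivity
  have hf1 := Nat.floor_le hpn
  have hf2 := Nat.lt_floor_add_one (p.1 * n)
  have hi : ⌊p.1 * n⌋₊ < n := by
    rw [Nat.floor_lt hpn]; nlinarith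
  set i := ⌊p.1 * n⌋₊
  have ha : (i : ℝ) / n ≤ p.1 := by rwa [div_le_iff₀ hn']
  have hb : p.1 < ((i : ℝ) + 1) / n := by rwa [lt_div_iff₀ hn']
  have hab : ((i : ℝ) + 1) / n = i / n + 1 / n := by ring
  have hinv : 1 / (n : ℝ) ≤ 1 := by rw [div_le_one hn']; exact hn1
  push_cast
  refine ⟨i, hi, by linarith, by linarith, by linarith, by linarith, ?_⟩
  have hterm : ∀ j : Fin n, 0 ≤ alphaJ n p.1 p.2 j * (1 - n * alphaJ n p.1 p.2 j) := by
    intro j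
    refine mul_nonneg (alphaJ_nonneg _ _ _ _) ?_
    have := alphaJ_le n h1.le j
    rw [le_div_iff₀ hn'] at this
    linarith
  refine le_trans ?_ (Finset.single_le_sum (fun j _ => hterm j) (Finset.mem_univ ⟨i, hi⟩))
  have hα : alphaJ n p.1 p.2 ⟨i, hi⟩ = min p.2 (((i : ℝ) + 1) / n) - p.1 := by
    rw [alphaJ_eq n h1.le]
    simp only
    rw [max_eq_right (le_min h1.le hb.le), max_eq_left ((min_le_right _ _).trans ha)]
  rw [hα]
  have hna : (n : ℝ) * (((i : ℝ) + 1) / n) = i + 1 := by field_simp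
  have hna' : (n : ℝ) * ((i : ℝ) / n) = i := by field_simp
  have hA : (p.2 - p.1) * (((i : ℝ) + 1) / n - p.1) ≤ min p.2 (((i : ℝ) + 1) / n) - p.1 := by
    rcases min_cases p.2 (((i : ℝ) + 1) / n) with ⟨h, _⟩ | ⟨h, _⟩ <;> rw [h] <;> nlinarith
  have hB : p.1 - (i : ℝ) / n ≤ 1 - n * (min p.2 (((i : ℝ) + 1) / n) - p.1) := by
    have := min_le_right p.2 (((i : ℝ) + 1) / n)
    nlinarith
  rw [← mul_assoc]
  refine mul_le_mul hA hB (by linarith) ?_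
  exact le_trans (mul_nonneg (by linarith) (by linarith)) hA

/-- Weinstein–Aronszajn identity for linear maps. -/
lemma LinearMap.det_one_add_comp_comm {V W : Type*} [AddCommGroup V] [Module ℝ V]
    [FiniteDimensional ℝ V] [AddCommGroup W] [Module ℝ W] [FiniteDimensional ℝ W]
    (A : V →ₗ[ℝ] W) (B : W →ₗ[ℝ] V) :
    LinearMap.det (LinearMap.id + B ∘ₗ A) = LinearMap.det (LinearMap.id + A ∘ₗ B) := by
  classical
  let bV := Module.finBasis ℝ V
  let bW := Module.finBasis ℝ W
  rw [← LinearMap.det_toMatrix bV, ← LinearMap.det_toMatrix bW, map_add, map_add,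
    LinearMap.toMatrix_comp bV bW bV, LinearMap.toMatrix_comp bW bV bW, LinearMap.toMatrix_id,
    LinearMap.toMatrix_id, Matrix.det_one_add_mul_comm]

/-- Image of a measure with density under an affine map. -/
lemma map_affine_withDensity {V : Type*} [NormedAddCommGroup V] [NormedSpace ℝ V]
    [MeasurableSpace V] [BorelSpace V] [FiniteDimensional ℝ V] (μ : Measure V)
    [μ.IsAddHaarMeasure] (f : V →ₗ[ℝ] V) (b : V) (hf : 0 < LinearMap.det f)
    (ρ q : V → ENNReal) (hρ : Measurable ρ) (hq : Measurable q)
    (h : ∀ x, ρ x = ENNReal.ofReal (LinearMap.det f) * (ρ (f x + b) * q (f x + b))) :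
    (μ.withDensity ρ).map (fun x => f x + b) = (μ.withDensity ρ).withDensity q := by
  have hfm : Measurable f := f.continuous_of_finiteDimensional.measurable
  have hT : Measurable (fun x => f x + b) := hfm.add_const b
  have hvol : μ.map (fun x => f x + b) = ENNReal.ofReal |(LinearMap.det f)⁻¹| • μ := by
    have : (fun x => f x + b) = (fun x => x + b) ∘ f := rfl
    rw [this, ← Measure.map_map (measurable_add_const b) hfm,
      Measure.map_linearMap_addHaar_eq_smul_addHaar μ hf.ne', Measure.map_smul,
      map_add_right_eq_self]
  rw [← withDensity_mul _ hρ hq]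
  ext s hs
  rw [Measure.map_apply hT hs, withDensity_apply _ (hT hs), withDensity_apply _ hs]
  calc ∫⁻ x in (fun x => f x + b) ⁻¹' s, ρ x ∂μ
      = ∫⁻ x in (fun x => f x + b) ⁻¹' s,
          ENNReal.ofReal (LinearMap.det f) * (ρ * q) (f x + b) ∂μ := by
        simp only [Pi.mul_apply, ← h]
    _ = ENNReal.ofReal (LinearMap.det f) * ∫⁻ y in s, (ρ * q) y ∂(μ.map fun x => f x + b) := by
        rw [setLIntegral_map hs (hρ.mul hq) hT]
        exact lintegral_const_mul _ ((hρ.mul hq).comp hT)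
    _ = ∫⁻ y in s, (ρ * q) y ∂μ := by
        rw [hvol, Measure.restrict_smul, lintegral_smul_measure, smul_eq_mul, ← mul_assoc,
          ← ENNReal.ofReal_mul hf.le, abs_of_pos (inv_pos.2 hf), mul_inv_cancel₀ hf.ne',
          ENNReal.ofReal_one, one_mul]

lemma gaussD_pos {d : ℕ} {ε : ℝ} (hε : 0 < ε) (z : EuclideanSpace ℝ (Fin d)) :
    0 < gaussD d ε z := by
  unfold gaussD; have := pi_pos; positivity

lemma measurable_gaussD (d : ℕ) :
    Measurable fun p : ℝ × EuclideanSpace ℝ (Fin d) => gaussD d p.1 p.2 := by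
  unfold gaussD; fun_prop

lemma continuous_gaussD (d : ℕ) (ε : ℝ) : Continuous (gaussD d ε) := by
  unfold gaussD; fun_prop

lemma integral_gaussD (d : ℕ) {ε : ℝ} (hε : 0 < ε) : ∫ z, gaussD d ε z = 1 := by
  have := pi_pos
  have h := GaussianFourier.integral_rexp_neg_mul_sq_norm (V := EuclideanSpace ℝ (Fin d))
    (b := (2 * ε)⁻¹) (by positivity)
  unfold gaussD
  rw [integral_const_mul]
  have e : ∀ z : EuclideanSpace ℝ (Fin d),
      rexp (-‖z‖ ^ 2 / (2 * ε)) = rexp (-(2 * ε)⁻¹ * ‖z‖ ^ 2) := fun z => by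
    congr 1; ring
  simp only [e]
  rw [h, finrank_euclideanSpace_fin, neg_div, rpow_neg (by positivity)]
  have e2 : π / (2 * ε)⁻¹ = 2 * π * ε := by field_simp
  rw [e2]
  exact inv_mul_cancel₀ (by positivity)

lemma integrable_gaussD (d : ℕ) {ε : ℝ} (hε : 0 < ε) : Integrable (gaussD d ε) := by
  by_contra h
  have := integral_gaussD d hε
  rw [integral_undef h] at this
  exact zero_ne_one this

/-- The shift `(x₁, …, x_n) ↦ (0, x₁, …, x_{n-1})`. -/
def shiftLM (n d : ℕ) :
    (Fin n → EuclideanSpace ℝ (Fin d)) →ₗ[ℝ] (Fin n → EuclideanSpace ℝ (Fin d)) where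
  toFun x j := (Fin.cons 0 x : Fin (n + 1) → EuclideanSpace ℝ (Fin d)) j.castSucc
  map_add' x y := by
    ext1 j
    simp only [Pi.add_apply]
    induction j.castSucc using Fin.cases <;> simp
  map_smul' a x := by
    ext1 j
    simp only [Pi.smul_apply]
    induction j.castSucc using Fin.cases <;> simp

lemma shiftLM_pow_apply (n d k : ℕ) (x : Fin n → EuclideanSpace ℝ (Fin d)) (j : Fin n)
    (hj : (j : ℕ) < k) : (shiftLM n d ^ k) x j = 0 := by
  induction k generalizing j with
  | zero => omega
  | succ k ih =>
    rw [pow_succ', Module.End.mul_apply]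
    change (Fin.cons 0 ((shiftLM n d ^ k) x) : Fin (n + 1) → EuclideanSpace ℝ (Fin d)) j.castSucc = 0
    rcases j with ⟨j, hjn⟩
    cases j with
    | zero => rfl
    | succ i => exact ih ⟨i, by omega⟩ (by simp at hj ⊢; omega)

/-- The increments as a linear map. -/
def padDiffLM (n d : ℕ) :
    (Fin n → EuclideanSpace ℝ (Fin d)) →ₗ[ℝ] (Fin n → EuclideanSpace ℝ (Fin d)) :=
  1 - shiftLM n d

lemma padDiffLM_apply {n d : ℕ} (x : Fin n → EuclideanSpace ℝ (Fin d)) :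
    padDiffLM n d x = padDiff x := by
  ext1 j; simp [padDiffLM, padDiff, shiftLM]

lemma det_padDiffLM (n d : ℕ) : LinearMap.det (padDiffLM n d) = 1 := by
  have hnil : IsNilpotent (shiftLM n d) :=
    ⟨n, LinearMap.ext fun x => funext fun j => shiftLM_pow_apply n d n x j j.2⟩
  have h := LinearMap.eval_charpoly (shiftLM n d) 1
  rw [hnil.charpoly_eq_X_pow_finrank] at h
  simpa [padDiffLM] using h.symm

lemma measurePreserving_padDiff (n d : ℕ) :
    MeasurePreserving (padDiff : (Fin n → EuclideanSpace ℝ (Fin d)) → _) := by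
  have e : (padDiff : (Fin n → EuclideanSpace ℝ (Fin d)) → _) = padDiffLM n d :=
    funext fun x => (padDiffLM_apply x).symm
  rw [e]
  refine ⟨(padDiffLM n d).continuous_of_finiteDimensional.measurable, ?_⟩
  rw [Measure.map_linearMap_addHaar_eq_smul_addHaar _ (by rw [det_padDiffLM]; exact one_ne_zero),
    det_padDiffLM]
  simp

lemma continuous_padDiff (n d : ℕ) :
    Continuous (padDiff : (Fin n → EuclideanSpace ℝ (Fin d)) → _) := by
  have e : (padDiff : (Fin n → EuclideanSpace ℝ (Fin d)) → _) = padDiffLM n d :=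
    funext fun x => (padDiffLM_apply x).symm
  rw [e]; exact (padDiffLM n d).continuous_of_finiteDimensional

/-- The Lebesgue density of `μ_n`. -/
noncomputable def rhoN (d n : ℕ) (x : Fin n → EuclideanSpace ℝ (Fin d)) : ENNReal :=
  ENNReal.ofReal (∏ j : Fin n, gaussD d (1 / n) (padDiff x j))

lemma measurable_rhoN (d n : ℕ) : Measurable (rhoN d n) := by
  unfold rhoN
  refine ENNReal.measurable_ofReal.comp (Finset.measurable_prod _ fun j _ => ?_)
  exact (continuous_gaussD d _).measurable.comp
    ((continuous_apply j).comp (continuous_padDiff n d)).measurable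

lemma muN_eq (d n : ℕ) : muN d n = volume.withDensity (rhoN d n) := rfl

lemma isProbabilityMeasure_muN (d : ℕ) {n : ℕ} (hn : 1 ≤ n) :
    IsProbabilityMeasure (muN d n) := by
  have hn' : (0 : ℝ) < 1 / n := by positivity
  constructor
  rw [muN_eq, withDensity_apply _ MeasurableSet.univ, Measure.restrict_univ]
  have hm : Measurable fun y : Fin n → EuclideanSpace ℝ (Fin d) =>
      ENNReal.ofReal (∏ j : Fin n, gaussD d (1 / n) (y j)) :=
    ENNReal.measurable_ofReal.comp (Finset.measurable_prod _ fun j _ =>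
      (continuous_gaussD d _).measurable.comp (measurable_pi_apply j))
  have h1 := (measurePreserving_padDiff n d).lintegral_comp hm
  unfold rhoN
  rw [h1, ← ofReal_integral_eq_lintegral_ofReal,
    integral_fintype_prod_volume_eq_prod (fun _ : Fin n => gaussD d (1 / n))]
  · simp [integral_gaussD d hn', -one_div]
  · exact Integrable.fintype_prod (fun _ => integrable_gaussD d hn')
  · exact Filter.Eventually.of_forall fun y => Finset.prod_nonneg fun j _ => (gaussD_pos hn' _).le

/-- The linear observation `x ↦ n ∑ α_j (x_j - x_{j-1})`. -/
noncomputable def obsLM {n d : ℕ} (α : Fin n → ℝ) :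
    (Fin n → EuclideanSpace ℝ (Fin d)) →ₗ[ℝ] EuclideanSpace ℝ (Fin d) :=
  (n : ℝ) • ∑ j, α j • (LinearMap.proj j ∘ₗ padDiffLM n d)

lemma obsLM_apply {n d : ℕ} (α : Fin n → ℝ) (x : Fin n → EuclideanSpace ℝ (Fin d)) :
    obsLM α x = (n : ℝ) • ∑ j, α j • padDiff x j := by
  simp [obsLM, ← padDiffLM_apply]

lemma padDiff_add {n d : ℕ} (x y : Fin n → EuclideanSpace ℝ (Fin d)) (j : Fin n) :
    padDiff (x + y) j = padDiff x j + padDiff y j := by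
  simp [← padDiffLM_apply]

lemma prod_gaussD {n d : ℕ} (hn : 1 ≤ n) (y : Fin n → EuclideanSpace ℝ (Fin d)) :
    ∏ j, gaussD d (1 / n) (y j) =
      ((2 * π * (1 / n)) ^ (-(d : ℝ) / 2)) ^ n * exp (-(n * ∑ j, ‖y j‖ ^ 2) / 2) := by
  have hn' : (n : ℝ) ≠ 0 := by positivity
  unfold gaussD
  rw [Finset.prod_mul_distrib, Finset.prod_const, Finset.card_univ, Fintype.card_fin, ← exp_sum]
  congr 2
  rw [Finset.mul_sum, ← Finset.sum_neg_distrib, Finset.sum_div]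
  refine Finset.sum_congr rfl fun j _ => ?_
  field_simp

lemma sq_norm_gaussian_identity {E : Type*} [NormedAddCommGroup E] [InnerProductSpace ℝ E]
    {s v : ℝ} (hs : 0 < s) (hv : 0 < v) (u z : E) :
    ‖(v / (s + v)) • u + √(s / (s + v)) • z‖ ^ 2 / v +
        ‖(v / (s + v)) • u + √(s / (s + v)) • z - u‖ ^ 2 / s =
      ‖u‖ ^ 2 / (s + v) + ‖z‖ ^ 2 / v := by
  have hr : √(s / (s + v)) ^ 2 = s / (s + v) := sq_sqrt (by positivity)
  have hsv : s + v ≠ 0 := by positivity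
  have e : (v / (s + v)) • u + √(s / (s + v)) • z - u =
      (-(s / (s + v))) • u + √(s / (s + v)) • z := by
    have : v / (s + v) = 1 - s / (s + v) := by field_simp; ring
    rw [this]; module
  rw [e, norm_add_sq_real, norm_add_sq_real]
  simp only [norm_smul, mul_pow, Real.norm_eq_abs, sq_abs, inner_smul_left, inner_smul_right,
    conj_trivial, hr]
  field_simp
  ring

/-- The affine map transporting `μ_n` to its posterior law given the observation `u`. -/
noncomputable def postMap (α c : Fin n → ℝ) (s v : ℝ) (u : EuclideanSpace ℝ (Fin d))
    (x : Fin n → EuclideanSpace ℝ (Fin d)) (j : Fin n) : EuclideanSpace ℝ (Fin d) :=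
  x j + c j • ((v / (s + v)) • u + (√(s / (s + v)) - 1) • obsLM α x)

lemma map_postMap (hn : 1 ≤ n) {α c : Fin n → ℝ} {s v : ℝ} (hs : 0 < s) (hv : 0 < v)
    (hα : n * ∑ j, α j ^ 2 = v)
    (hc : ∀ (w : EuclideanSpace ℝ (Fin d)) (j : Fin n),
      padDiff (fun i => c i • w) j = (α j / v) • w) (u : EuclideanSpace ℝ (Fin d)) :
    (muN d n).map (postMap α c s v u) = (muN d n).withDensity
      fun x => ENNReal.ofReal (gaussD d s (obsLM α x - u) / gaussD d (s + v) u) := by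
  have hπ := pi_pos
  set r := s / (s + v) with hr
  have hr0 : 0 < √r := sqrt_pos.2 (by positivity)
  let B : EuclideanSpace ℝ (Fin d) →ₗ[ℝ] (Fin n → EuclideanSpace ℝ (Fin d)) :=
    LinearMap.pi fun j => (c j * (√r - 1)) • LinearMap.id
  have hobs : ∀ w : EuclideanSpace ℝ (Fin d), obsLM α (fun i => c i • w) = w := by
    intro w
    rw [obsLM_apply]
    simp only [hc, smul_smul]
    rw [← Finset.sum_smul, smul_smul]
    have : (n : ℝ) * ∑ j, α j * (α j / v) = 1 := by
      simp only [← mul_div_assoc, ← sq]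
      rw [← Finset.sum_div, ← mul_div_assoc, hα, div_self hv.ne']
    rw [this, one_smul]
  have hB : ∀ w, B w = fun i => c i • ((√r - 1) • w) := by
    intro w; ext1 i; simp [B, smul_smul]
  have hAB : LinearMap.id + obsLM α ∘ₗ B = √r • LinearMap.id := by
    ext1 w
    simp only [LinearMap.add_apply, LinearMap.id_apply, LinearMap.comp_apply, hB, hobs,
      LinearMap.smul_apply]
    module
  let f : (Fin n → EuclideanSpace ℝ (Fin d)) →ₗ[ℝ] (Fin n → EuclideanSpace ℝ (Fin d)) :=
    LinearMap.id + B ∘ₗ obsLM α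
  have hdet : LinearMap.det f = √r ^ d := by
    rw [show f = LinearMap.id + B ∘ₗ obsLM α from rfl, LinearMap.det_one_add_comp_comm, hAB,
      LinearMap.det_smul]
    simp
  have hfx : ∀ x, f x + (fun i => c i • ((v / (s + v)) • u)) =
      x + fun i => c i • ((v / (s + v)) • u + (√r - 1) • obsLM α x) := by
    intro x
    funext j
    simp only [f, LinearMap.add_apply, LinearMap.id_apply, LinearMap.comp_apply, hB,
      Pi.add_apply]
    module
  have hT : postMap α c s v u = fun x => f x + fun i => c i • ((v / (s + v)) • u) := by
    simp only [hfx]; rfl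
  have hobsm : Measurable (obsLM (d := d) α) :=
    (obsLM α).continuous_of_finiteDimensional.measurable
  rw [hT, muN_eq]
  refine map_affine_withDensity _ _ _ (by rw [hdet]; positivity) _ _ (measurable_rhoN d n) ?_ ?_
  · exact ENNReal.measurable_ofReal.comp
      (((continuous_gaussD d s).measurable.comp (hobsm.sub_const u)).div_const _)
  intro x
  rw [hfx, hdet]
  set w := (v / (s + v)) • u + (√r - 1) • obsLM α x with hw
  have hz : obsLM α (x + fun i => c i • w) = (v / (s + v)) • u + √r • obsLM α x := by
    rw [map_add, hobs, hw]; module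
  have hn' : (0 : ℝ) < 1 / n := by positivity
  unfold rhoN
  simp only [padDiff_add, hc, hz]
  rw [← ENNReal.ofReal_mul (Finset.prod_nonneg fun j _ => (gaussD_pos hn' _).le),
    ← ENNReal.ofReal_mul (by positivity)]
  congr 1
  rw [prod_gaussD hn, prod_gaussD hn]
  have hsum : (n : ℝ) * ∑ j, ‖padDiff x j + (α j / v) • w‖ ^ 2 =
      n * ∑ j, ‖padDiff x j‖ ^ 2 +
        (‖(v / (s + v)) • u + √r • obsLM α x‖ ^ 2 - ‖obsLM α x‖ ^ 2) / v := by
    have e1 : (v / (s + v)) • u + √r • obsLM α x = obsLM α x + w := by rw [hw]; module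
    have e2 : inner ℝ (obsLM α x) w = n * ∑ j, α j * inner ℝ (padDiff x j) w := by
      rw [obsLM_apply, inner_smul_left, sum_inner]
      simp [inner_smul_left]
    rw [e1, norm_add_sq_real, e2]
    simp only [norm_add_sq_real, norm_smul, inner_smul_right, mul_pow, Real.norm_eq_abs, sq_abs,
      Finset.sum_add_distrib, div_pow]
    rw [← Finset.sum_mul, ← Finset.sum_div]
    have e3 : ∑ j, 2 * (α j / v * inner ℝ (padDiff x j) w) =
        2 / v * ∑ j, α j * inner ℝ (padDiff x j) w := by
      rw [Finset.mul_sum]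
      exact Finset.sum_congr rfl fun j _ => by ring
    have e4 : (n : ℝ) * ((∑ j, α j ^ 2) / v ^ 2 * ‖w‖ ^ 2) = ‖w‖ ^ 2 / v := by
      rw [← mul_assoc, ← mul_div_assoc, hα]; field_simp
    rw [e3, mul_add, mul_add, e4]
    field_simp
    ring
  have hid := sq_norm_gaussian_identity hs hv u (obsLM α x)
  rw [← hr] at hid
  rw [hsum]
  unfold gaussD
  have hpre : √r ^ d * (2 * π * s) ^ (-(d : ℝ) / 2) = (2 * π * (s + v)) ^ (-(d : ℝ) / 2) := by
    have e1 : (2 * π * s) = r * (2 * π * (s + v)) := by rw [hr]; field_simp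
    have e2 : √r ^ d = r ^ ((d : ℝ) / 2) := by
      rw [sqrt_eq_rpow, ← rpow_natCast, ← rpow_mul (by positivity)]; congr 1; ring
    have hr1 : 0 < r := by positivity
    rw [e1, mul_rpow hr1.le (by positivity), e2, ← mul_assoc, ← rpow_add hr1]
    rw [show (d : ℝ) / 2 + -(d : ℝ) / 2 = 0 by ring, rpow_zero, one_mul]
  have hexp : rexp (-(n * ∑ j, ‖padDiff x j‖ ^ 2) / 2) =
      rexp (-(n * ∑ j, ‖padDiff x j‖ ^ 2 +
        (‖(v / (s + v)) • u + √r • obsLM α x‖ ^ 2 - ‖obsLM α x‖ ^ 2) / v) / 2) *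
      (rexp (-‖(v / (s + v)) • u + √r • obsLM α x - u‖ ^ 2 / (2 * s)) /
        rexp (-‖u‖ ^ 2 / (2 * (s + v)))) := by
    rw [← exp_sub, ← exp_add]
    congr 1
    have e5 : -‖(v / (s + v)) • u + √r • obsLM α x - u‖ ^ 2 / (2 * s) =
      -(‖(v / (s + v)) • u + √r • obsLM α x - u‖ ^ 2 / s) / 2 := by field_simp
    have e6 : -‖u‖ ^ 2 / (2 * (s + v)) = -(‖u‖ ^ 2 / (s + v)) / 2 := by field_simp
    rw [e5, e6, sub_div]
    linarith
  rw [hexp, ← hpre]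
  have h1 : (2 * π * s) ^ (-(d : ℝ) / 2) ≠ 0 := by positivity
  field_simp

lemma continuous_obsLM (α : Fin n → ℝ) : Continuous (obsLM (d := d) α) :=
  (obsLM α).continuous_of_finiteDimensional

lemma measurable_postMap (α c : Fin n → ℝ) (s v : ℝ) (u : EuclideanSpace ℝ (Fin d)) :
    Measurable (postMap α c s v u) := by
  have := (continuous_obsLM (d := d) α)
  have : Continuous (postMap α c s v u) := by unfold postMap; fun_prop
  exact this.measurable

lemma lintegral_gaussD_obsLM (hn : 1 ≤ n) {α c : Fin n → ℝ} {s v : ℝ} (hs : 0 < s) (hv : 0 < v)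
    (hα : n * ∑ j, α j ^ 2 = v)
    (hc : ∀ (w : EuclideanSpace ℝ (Fin d)) (j : Fin n),
      padDiff (fun i => c i • w) j = (α j / v) • w) (u : EuclideanSpace ℝ (Fin d)) :
    ∫⁻ x, ENNReal.ofReal (gaussD d s (obsLM α x - u)) ∂(muN d n) =
      ENNReal.ofReal (gaussD d (s + v) u) := by
  have := isProbabilityMeasure_muN d hn
  have h := congrArg (fun m => m Set.univ) (map_postMap hn hs hv hα hc u)
  rw [Measure.map_apply (measurable_postMap _ _ _ _ _) MeasurableSet.univ, Set.preimage_univ,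
    measure_univ, withDensity_apply _ MeasurableSet.univ, Measure.restrict_univ] at h
  have hτ := gaussD_pos (add_pos hs hv) u
  have hm : Measurable fun x => ENNReal.ofReal (gaussD d s (obsLM α x - u)) :=
    ENNReal.measurable_ofReal.comp ((continuous_gaussD d s).comp
      ((continuous_obsLM α).sub continuous_const)).measurable
  simp only [div_eq_mul_inv, ENNReal.ofReal_mul (gaussD_pos hs _).le] at h
  rw [lintegral_mul_const _ hm, ENNReal.ofReal_inv_of_pos hτ] at h
  rw [← div_eq_mul_inv] at h
  have := (ENNReal.eq_div_iff (by simpa using hτ) ENNReal.ofReal_ne_top).1 h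
  rw [← this, mul_one]

lemma one_sub_le_div_rpow {s v : ℝ} (hs : 0 < s) (hv : 0 < v) (d : ℕ) :
    2 * s * (1 - (s / (s + v)) ^ ((d : ℝ) / 2)) ≤ d * v := by
  have h1 : (s / (s + v)) ^ ((d : ℝ) / 2) = exp (-((d : ℝ) / 2) * log ((s + v) / s)) := by
    rw [rpow_def_of_pos (by positivity), ← inv_div, log_inv]; congr 1; ring
  have h2 := add_one_le_exp (-((d : ℝ) / 2) * log ((s + v) / s))
  have h3 := log_le_sub_one_of_pos (show 0 < (s + v) / s by positivity)
  have h4 : (s + v) / s - 1 = v / s := by field_simp; ring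
  rw [h4] at h3
  rw [h1]
  have h5 : 1 - exp (-((d : ℝ) / 2) * log ((s + v) / s)) ≤ (d / 2) * (v / s) := by
    have : (d : ℝ) / 2 * log ((s + v) / s) ≤ (d / 2) * (v / s) := by gcongr
    linarith
  calc _ ≤ 2 * s * ((d / 2) * (v / s)) := by gcongr
    _ = d * v := by field_simp

lemma lintegral_sq_norm_obsLM_le (hn : 1 ≤ n) {α c : Fin n → ℝ} {v : ℝ} (hv : 0 < v)
    (hα : n * ∑ j, α j ^ 2 = v)
    (hc : ∀ (w : EuclideanSpace ℝ (Fin d)) (j : Fin n),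
      padDiff (fun i => c i • w) j = (α j / v) • w) :
    ∫⁻ x, ENNReal.ofReal (‖obsLM (d := d) α x‖ ^ 2) ∂(muN d n) ≤ ENNReal.ofReal (d * v) := by
  have := isProbabilityMeasure_muN d hn
  have hπ := pi_pos
  have hz := continuous_obsLM (d := d) α
  have hexp : ∀ s : ℝ, 0 < s → ∫ x, exp (-‖obsLM (d := d) α x‖ ^ 2 / (2 * s)) ∂(muN d n) =
      (s / (s + v)) ^ ((d : ℝ) / 2) := by
    intro s hs
    have h := lintegral_gaussD_obsLM hn hs hv hα hc 0
    have hpre : 0 < (2 * π * s) ^ (-(d : ℝ) / 2) := by positivity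
    have hcont : Continuous fun x => gaussD d s (obsLM (d := d) α x - 0) :=
      (continuous_gaussD d s).comp (hz.sub continuous_const)
    have h2 : ∫ x, gaussD d s (obsLM α x - 0) ∂(muN d n) = gaussD d (s + v) 0 := by
      rw [integral_eq_lintegral_of_nonneg_ae
        (Filter.Eventually.of_forall fun x => (gaussD_pos hs _).le)
        hcont.aestronglyMeasurable, h,
        ENNReal.toReal_ofReal (gaussD_pos (by positivity) _).le]
    unfold gaussD at h2
    rw [integral_const_mul] at h2
    simp only [sub_zero, norm_zero] at h2
    have h3 : (s / (s + v)) ^ ((d : ℝ) / 2) * (2 * π * s) ^ (-(d : ℝ) / 2) =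
        (2 * π * (s + v)) ^ (-(d : ℝ) / 2) := by
      rw [show 2 * π * s = (s / (s + v)) * (2 * π * (s + v)) by field_simp,
        mul_rpow (by positivity) (by positivity), ← mul_assoc, ← rpow_add (by positivity),
        show (d : ℝ) / 2 + -(d : ℝ) / 2 = 0 by ring, rpow_zero, one_mul]
    rw [← h3] at h2
    simp only [ne_eq, OfNat.ofNat_ne_zero, not_false_eq_true, zero_pow, neg_zero, zero_div,
      exp_zero, mul_one] at h2
    rw [mul_comm] at h2
    exact mul_right_cancel₀ hpre.ne' h2
  have hbound : ∀ s : ℝ, 0 < s →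
      ∫⁻ x, ENNReal.ofReal (‖obsLM (d := d) α x‖ ^ 2 / (1 + ‖obsLM (d := d) α x‖ ^ 2 / (2 * s)))
        ∂(muN d n) ≤ ENNReal.ofReal (d * v) := by
    intro s hs
    have hInt : Integrable (fun x => exp (-‖obsLM (d := d) α x‖ ^ 2 / (2 * s))) (muN d n) := by
      refine Integrable.of_bound (by fun_prop) 1 (Filter.Eventually.of_forall fun x => ?_)
      rw [Real.norm_eq_abs, abs_exp, exp_le_one_iff, neg_div, Left.neg_nonpos_iff]
      positivity
    have hint2 : Integrable (fun x => 2 * s * (1 - exp (-‖obsLM (d := d) α x‖ ^ 2 / (2 * s))))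
        (muN d n) := ((integrable_const 1).sub hInt).const_mul _
    have hle : ∀ x, ‖obsLM (d := d) α x‖ ^ 2 / (1 + ‖obsLM (d := d) α x‖ ^ 2 / (2 * s)) ≤
        2 * s * (1 - exp (-‖obsLM (d := d) α x‖ ^ 2 / (2 * s))) := by
      intro x
      set y := ‖obsLM (d := d) α x‖ ^ 2 / (2 * s) with hy
      have hy0 : 0 ≤ y := by positivity
      have e1 : ‖obsLM (d := d) α x‖ ^ 2 = 2 * s * y := by rw [hy]; field_simp
      rw [neg_div, ← hy, e1, mul_div_assoc]
      gcongr
      have h1 := add_one_le_exp y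
      rw [exp_neg]
      have h2 : (exp y)⁻¹ ≤ (1 + y)⁻¹ := by
        apply inv_anti₀ (by positivity); linarith
      have h3 : y / (1 + y) = 1 - (1 + y)⁻¹ := by field_simp; ring
      linarith
    calc _ ≤ ∫⁻ x, ENNReal.ofReal (2 * s * (1 - exp (-‖obsLM (d := d) α x‖ ^ 2 / (2 * s))))
            ∂(muN d n) := lintegral_mono fun x => ENNReal.ofReal_le_ofReal (hle x)
      _ = ENNReal.ofReal (∫ x, 2 * s * (1 - exp (-‖obsLM (d := d) α x‖ ^ 2 / (2 * s)))
            ∂(muN d n)) := by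
          rw [ofReal_integral_eq_lintegral_ofReal hint2]
          exact Filter.Eventually.of_forall fun x => le_trans (by positivity) (hle x)
      _ ≤ ENNReal.ofReal (d * v) := by
          rw [integral_const_mul, integral_sub (integrable_const 1) hInt, hexp s hs]
          simp only [integral_const, probReal_univ, smul_eq_mul, mul_one]
          exact ENNReal.ofReal_le_ofReal (one_sub_le_div_rpow hs hv d)
  have hlim : ∀ x, Filter.liminf (fun k : ℕ => ENNReal.ofReal (‖obsLM (d := d) α x‖ ^ 2 /
      (1 + ‖obsLM (d := d) α x‖ ^ 2 / (2 * ((k : ℝ) + 1))))) Filter.atTop =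
      ENNReal.ofReal (‖obsLM (d := d) α x‖ ^ 2) := by
    intro x
    apply Filter.Tendsto.liminf_eq
    apply ENNReal.tendsto_ofReal
    set a := ‖obsLM (d := d) α x‖ ^ 2
    have h1 : Filter.Tendsto (fun k : ℕ => a / 2 * (1 / ((k : ℝ) + 1))) Filter.atTop
        (nhds (a / 2 * 0)) := tendsto_one_div_add_atTop_nhds_zero_nat.const_mul _
    have h2 := (tendsto_const_nhds (x := a)).div
      ((tendsto_const_nhds (x := (1 : ℝ))).add h1) (by simp)
    simp only [mul_zero, add_zero, div_one] at h2
    refine h2.congr fun k => ?_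
    simp only [Pi.div_apply]
    congr 2
    field_simp
  calc _ = ∫⁻ x, Filter.liminf (fun k : ℕ => ENNReal.ofReal (‖obsLM (d := d) α x‖ ^ 2 /
      (1 + ‖obsLM (d := d) α x‖ ^ 2 / (2 * ((k : ℝ) + 1))))) Filter.atTop ∂(muN d n) := by
        simp only [hlim]
    _ ≤ Filter.liminf (fun k : ℕ => ∫⁻ x, ENNReal.ofReal (‖obsLM (d := d) α x‖ ^ 2 /
      (1 + ‖obsLM (d := d) α x‖ ^ 2 / (2 * ((k : ℝ) + 1)))) ∂(muN d n)) Filter.atTop :=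
        lintegral_liminf_le fun k => by fun_prop
    _ ≤ Filter.liminf (fun _ : ℕ => ENNReal.ofReal (d * v)) Filter.atTop :=
        Filter.liminf_le_liminf (Filter.Eventually.of_forall fun k => hbound _ (by positivity))
    _ = ENNReal.ofReal (d * v) := Filter.liminf_const _

lemma lintegral_muN_neg {g : (Fin n → EuclideanSpace ℝ (Fin d)) → ENNReal} (hg : Measurable g) :
    ∫⁻ x, g (-x) ∂(muN d n) = ∫⁻ x, g x ∂(muN d n) := by
  have hρ : ∀ x, rhoN d n (-x) = rhoN d n x := by
    intro x
    simp [rhoN, gaussD, ← padDiffLM_apply]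
  have hvol : (volume : Measure (Fin n → EuclideanSpace ℝ (Fin d))).IsNegInvariant := by
    constructor
    have h := Measure.map_linearMap_addHaar_eq_smul_addHaar
      (volume : Measure (Fin n → EuclideanSpace ℝ (Fin d)))
      (f := (-1 : ℝ) • LinearMap.id) (by rw [LinearMap.det_smul]; simp)
    rw [LinearMap.det_smul] at h
    simp only [LinearMap.det_id, mul_one, abs_inv, abs_pow, abs_neg, abs_one, one_pow, inv_one,
      ENNReal.ofReal_one, one_smul] at h
    have e : ⇑((-1 : ℝ) • (LinearMap.id : (Fin n → EuclideanSpace ℝ (Fin d)) →ₗ[ℝ] _)) =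
        Neg.neg := by
      funext x; simp
    rwa [e] at h
  have hg' : Measurable fun x => g (-x) := hg.comp measurable_neg
  rw [muN_eq, lintegral_withDensity_eq_lintegral_mul _ (measurable_rhoN d n) hg,
    lintegral_withDensity_eq_lintegral_mul _ (measurable_rhoN d n) hg',
    ← (Measure.measurePreserving_neg volume).lintegral_comp ((measurable_rhoN d n).mul hg)]
  simp [hρ]

lemma lintegral_sq_norm_affine_le (hn : 1 ≤ n) {α c : Fin n → ℝ} {v : ℝ} (hv : 0 < v)
    (hα : n * ∑ j, α j ^ 2 = v)
    (hc : ∀ (w : EuclideanSpace ℝ (Fin d)) (j : Fin n),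
      padDiff (fun i => c i • w) j = (α j / v) • w) (β η : ℝ) (u : EuclideanSpace ℝ (Fin d)) :
    ∫⁻ x, ENNReal.ofReal (‖β • u + η • obsLM α x‖ ^ 2) ∂(muN d n) ≤
      ENNReal.ofReal (β ^ 2 * ‖u‖ ^ 2 + η ^ 2 * (d * v)) := by
  have := isProbabilityMeasure_muN d hn
  have hz := continuous_obsLM (d := d) α
  set F : (Fin n → EuclideanSpace ℝ (Fin d)) → ENNReal :=
    fun x => ENNReal.ofReal (‖β • u + η • obsLM α x‖ ^ 2)
  have hF : Measurable F := by fun_prop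
  have h2 : 2 * ∫⁻ x, F x ∂(muN d n) ≤
      2 * ENNReal.ofReal (β ^ 2 * ‖u‖ ^ 2 + η ^ 2 * (d * v)) := by
    calc 2 * ∫⁻ x, F x ∂(muN d n) = ∫⁻ x, (F x + F (-x)) ∂(muN d n) := by
          rw [lintegral_add_left hF, lintegral_muN_neg hF, two_mul]
      _ = ∫⁻ x, (ENNReal.ofReal (2 * (β ^ 2 * ‖u‖ ^ 2)) +
            ENNReal.ofReal (2 * η ^ 2) * ENNReal.ofReal (‖obsLM (d := d) α x‖ ^ 2)) ∂(muN d n) := by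
          refine lintegral_congr fun x => ?_
          simp only [F]
          rw [← ENNReal.ofReal_add (by positivity) (by positivity),
            ← ENNReal.ofReal_mul (by positivity),
            ← ENNReal.ofReal_add (by positivity) (by positivity)]
          congr 1
          rw [map_neg, norm_add_sq_real, norm_add_sq_real]
          simp only [smul_neg, inner_neg_right, norm_neg, norm_smul, mul_pow, Real.norm_eq_abs,
            sq_abs]
          ring
      _ ≤ ENNReal.ofReal (2 * (β ^ 2 * ‖u‖ ^ 2)) +
            ENNReal.ofReal (2 * η ^ 2) * ENNReal.ofReal (d * v) := by
          rw [lintegral_add_left measurable_const, lintegral_const_mul _ (by fun_prop)]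
          simp only [lintegral_const, measure_univ, mul_one]
          gcongr
          exact lintegral_sq_norm_obsLM_le hn hv hα hc
      _ = 2 * ENNReal.ofReal (β ^ 2 * ‖u‖ ^ 2 + η ^ 2 * (d * v)) := by
          rw [← ENNReal.ofReal_mul (by positivity),
            ← ENNReal.ofReal_add (by positivity) (by positivity),
            show 2 * (β ^ 2 * ‖u‖ ^ 2) + 2 * η ^ 2 * (d * v) =
              2 * (β ^ 2 * ‖u‖ ^ 2 + η ^ 2 * (d * v)) by ring, ENNReal.ofReal_mul (by positivity),
            ENNReal.ofReal_ofNat]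
  exact (ENNReal.mul_le_mul_iff_right (by simp) (by simp)).1 h2

lemma measurableSet_Delta2 : MeasurableSet Delta2 :=
  (measurableSet_le measurable_const measurable_fst).inter
    ((measurableSet_lt measurable_fst measurable_snd).inter
      (measurableSet_le measurable_snd measurable_const))

lemma Delta2_subset : Delta2 ⊆ Set.Icc 0 1 ×ˢ Set.Icc 0 1 := fun _ hp =>
  ⟨⟨hp.1, hp.2.1.le.trans hp.2.2⟩, ⟨hp.1.trans hp.2.1.le, hp.2.2⟩⟩

lemma volume_Delta2 : volume Delta2 = ENNReal.ofReal (1 / 2) := by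
  rw [Measure.volume_eq_prod, Measure.prod_apply measurableSet_Delta2]
  have h : ∀ s : ℝ, volume (Prod.mk s ⁻¹' Delta2) =
      (Set.Icc (0 : ℝ) 1).indicator (fun s => ENNReal.ofReal (1 - s)) s := by
    intro s
    have e : Prod.mk s ⁻¹' Delta2 = {t | 0 ≤ s ∧ t ∈ Set.Ioc s 1} := rfl
    rw [e]
    by_cases hs : s ∈ Set.Icc (0 : ℝ) 1
    · rw [Set.indicator_of_mem hs]
      simp only [hs.1, true_and]
      exact Real.volume_Ioc
    · rw [Set.indicator_of_notMem hs]
      convert measure_empty (μ := (volume : Measure ℝ)) using 2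
      ext t
      simp only [Set.mem_ofPred_eq, Set.mem_Ioc, Set.mem_empty_iff_false, iff_false]
      rintro ⟨h0, h1, h2⟩
      exact hs ⟨h0, h1.le.trans h2⟩
  simp only [h]
  rw [lintegral_indicator measurableSet_Icc, ← ofReal_integral_eq_lintegral_ofReal]
  · rw [integral_Icc_eq_integral_Ioc, ← intervalIntegral.integral_of_le zero_le_one]
    congr 1
    rw [intervalIntegral.integral_sub (by simp) (by simp)]
    simp
    norm_num
  · exact (by fun_prop : Continuous fun s : ℝ => 1 - s).integrableOn_Icc
  · filter_upwards [ae_restrict_mem measurableSet_Icc] with s hs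
    simpa using hs.2

instance : IsFiniteMeasure (volume.restrict Delta2) :=
  ⟨by rw [Measure.restrict_apply_univ, volume_Delta2]; exact ENNReal.ofReal_lt_top⟩

lemma measurable_alphaJ (j : Fin n) : Measurable fun p : ℝ × ℝ => alphaJ n p.1 p.2 j := by
  unfold alphaJ
  simp only [Set.Icc_inter_Icc, Real.volume_Icc]
  fun_prop

lemma measurable_sigma2 : Measurable fun p : ℝ × ℝ => sigma2 n p.1 p.2 := by
  unfold sigma2
  exact (measurable_snd.sub measurable_fst).sub
    ((Finset.measurable_sum _ fun j _ => (measurable_alphaJ j).pow_const 2).const_mul _)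

lemma gaussD_le_mul (d : ℕ) {u : EuclideanSpace ℝ (Fin d)} (hu : u ≠ 0) :
    ∃ C : ℝ, 0 ≤ C ∧ ∀ τ : ℝ, 0 < τ → τ ≤ 1 → gaussD d τ u ≤ C * τ := by
  have hu' : 0 < ‖u‖ := norm_pos_iff.2 hu
  have hπ := pi_gt_three
  refine ⟨(d + 1).factorial * (2 / ‖u‖ ^ 2) ^ (d + 1), by positivity, fun τ h0 h1 => ?_⟩
  have hx : 0 < ‖u‖ ^ 2 / (2 * τ) := by positivity
  have h2 : exp (-‖u‖ ^ 2 / (2 * τ)) ≤ (d + 1).factorial * (2 / ‖u‖ ^ 2 * τ) ^ (d + 1) := by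
    have := pow_div_factorial_le_exp _ hx.le (d + 1)
    rw [neg_div, exp_neg]
    have e : (d + 1).factorial * (2 / ‖u‖ ^ 2 * τ) ^ (d + 1) =
        ((‖u‖ ^ 2 / (2 * τ)) ^ (d + 1) / (d + 1).factorial)⁻¹ := by
      rw [inv_div, div_eq_mul_inv ((d + 1).factorial : ℝ), ← inv_pow (‖u‖ ^ 2 / (2 * τ)), inv_div]
      congr 2
      ring
    rw [e]
    exact inv_anti₀ (by positivity) this
  have h3 : (2 * π * τ) ^ (-(d : ℝ) / 2) ≤ (τ ^ d)⁻¹ := by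
    calc (2 * π * τ) ^ (-(d : ℝ) / 2) ≤ τ ^ (-(d : ℝ) / 2) := by
          apply rpow_le_rpow_of_nonpos h0 (by nlinarith)
          have : (0 : ℝ) ≤ d := by positivity
          linarith
      _ ≤ τ ^ (-(d : ℝ)) := by
          apply rpow_le_rpow_of_exponent_ge h0 h1
          have : (0 : ℝ) ≤ d := by positivity
          linarith
      _ = (τ ^ d)⁻¹ := by rw [rpow_neg h0.le, rpow_natCast]
  unfold gaussD
  calc _ ≤ (τ ^ d)⁻¹ * ((d + 1).factorial * (2 / ‖u‖ ^ 2 * τ) ^ (d + 1)) := by gcongr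
    _ = _ := by rw [mul_pow]; field_simp; ring

lemma integrable_of_gaussD_weight (d : ℕ) {u : EuclideanSpace ℝ (Fin d)} (hu : u ≠ 0) {g : ℝ → ℝ}
    (hg : Measurable g) {K : ℝ} (hgb : ∀ τ, 0 < τ → τ ≤ 1 → |g τ| ≤ K / τ) :
    IntegrableOn (fun p : ℝ × ℝ => g (p.2 - p.1) * gaussD d (p.2 - p.1) u) Delta2 := by
  obtain ⟨C, hC, hb⟩ := gaussD_le_mul d hu
  have hm : Measurable fun p : ℝ × ℝ => g (p.2 - p.1) * gaussD d (p.2 - p.1) u :=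
    (hg.comp (measurable_snd.sub measurable_fst)).mul
      ((measurable_gaussD d).comp ((measurable_snd.sub measurable_fst).prodMk measurable_const))
  refine Integrable.of_bound hm.aestronglyMeasurable (K * C) ?_
  filter_upwards [ae_restrict_mem measurableSet_Delta2] with p hp
  have h0 : 0 < p.2 - p.1 := sub_pos.2 hp.2.1
  have h1 : p.2 - p.1 ≤ 1 := by linarith [hp.1, hp.2.2]
  rw [Real.norm_eq_abs, abs_mul, abs_of_pos (gaussD_pos h0 u)]
  calc _ ≤ K / (p.2 - p.1) * (C * (p.2 - p.1)) := by
        have := gaussD_pos h0 u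
        exact mul_le_mul (hgb _ h0 h1) (hb _ h0 h1) this.le ((abs_nonneg _).trans (hgb _ h0 h1))
    _ = K * C := by field_simp

lemma abs_log_le_one_div {τ : ℝ} (h0 : 0 < τ) (h1 : τ ≤ 1) : |log τ| ≤ 1 / τ := by
  rw [abs_of_nonpos (log_nonpos h0.le h1), ← log_inv]
  have := log_le_sub_one_of_pos (inv_pos.2 h0)
  rw [one_div]; linarith

lemma integrableOn_gaussD (d : ℕ) {u : EuclideanSpace ℝ (Fin d)} (hu : u ≠ 0) :
    IntegrableOn (fun p : ℝ × ℝ => gaussD d (p.2 - p.1) u) Delta2 := by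
  have := integrable_of_gaussD_weight d hu (g := fun _ => 1) measurable_const (K := 1)
    fun τ h0 h1 => by rw [abs_one, le_div_iff₀ h0]; linarith
  simpa using this

lemma integrableOn_log_gaussD (d : ℕ) {u : EuclideanSpace ℝ (Fin d)} (hu : u ≠ 0) :
    IntegrableOn (fun p : ℝ × ℝ => log (p.2 - p.1) * gaussD d (p.2 - p.1) u) Delta2 :=
  integrable_of_gaussD_weight d hu measurable_log fun _ => abs_log_le_one_div

lemma integrableOn_inv_gaussD (d : ℕ) {u : EuclideanSpace ℝ (Fin d)} (hu : u ≠ 0) (K : ℝ) :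
    IntegrableOn (fun p : ℝ × ℝ => K / (p.2 - p.1) * gaussD d (p.2 - p.1) u) Delta2 :=
  integrable_of_gaussD_weight d hu (g := fun τ => K / τ) (by fun_prop) (K := |K|)
    fun τ h0 _ => by rw [abs_div, abs_of_pos h0]

lemma mUD_pos (d : ℕ) {u : EuclideanSpace ℝ (Fin d)} (hu : u ≠ 0) : 0 < mUD d u := by
  unfold mUD
  rw [setIntegral_pos_iff_support_of_nonneg_ae _ (integrableOn_gaussD d hu)]
  · have : Delta2 ⊆ Function.support fun p : ℝ × ℝ => gaussD d (p.2 - p.1) u :=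
      fun p hp => (gaussD_pos (sub_pos.2 hp.2.1) u).ne'
    rw [Set.inter_eq_right.2 this, volume_Delta2]
    simp
  · filter_upwards [ae_restrict_mem measurableSet_Delta2] with p hp
    exact (gaussD_pos (sub_pos.2 hp.2.1) u).le

lemma ae_fst_ne (n : ℕ) : ∀ᵐ p : ℝ × ℝ ∂(volume.restrict Delta2), ∀ k : ℕ, p.1 ≠ (k : ℝ) / n := by
  refine ae_restrict_of_ae (ae_all_iff.2 fun k => ?_)
  have : ∀ᵐ s : ℝ, s ≠ (k : ℝ) / n := by simp [ae_iff]
  exact Measure.quasiMeasurePreserving_fst.ae this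

lemma sigma2_pos_and_log_bound (hn : 1 ≤ n) {p : ℝ × ℝ} (hp : p ∈ Delta2)
    (hne : ∀ k : ℕ, p.1 ≠ (k : ℝ) / n) :
    0 < sigma2 n p.1 p.2 ∧ |log (sigma2 n p.1 p.2)| ≤
      |log (p.2 - p.1)| + ∑ k ∈ Finset.range (n + 1), |log (p.1 - (k : ℝ) / n)| := by
  obtain ⟨i, hi, ha0, ha1, hb0, hb1, hle⟩ := sigma2_lower hn hp
  have ha : 0 < p.1 - (i : ℝ) / n := lt_of_le_of_ne ha0 (sub_ne_zero.2 (hne i)).symm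
  have hb : 0 < ((i + 1 : ℕ) : ℝ) / n - p.1 := lt_of_le_of_ne hb0 (sub_ne_zero.2 (hne (i + 1)).symm).symm
  have h0 : 0 < p.2 - p.1 := sub_pos.2 hp.2.1
  have h1 : p.2 - p.1 ≤ 1 := by linarith [hp.1, hp.2.2]
  have hpos : 0 < sigma2 n p.1 p.2 := lt_of_lt_of_le (by positivity) hle
  refine ⟨hpos, ?_⟩
  rw [abs_of_nonpos (log_nonpos hpos.le ((sigma2_le p).trans h1))]
  have h2 := log_le_log (by positivity) hle
  rw [log_mul h0.ne' (by positivity), log_mul hb.ne' ha.ne'] at h2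
  have e : log (((i + 1 : ℕ) : ℝ) / n - p.1) = log (p.1 - ((i + 1 : ℕ) : ℝ) / n) := by
    rw [← log_neg_eq_log, neg_sub]
  rw [e] at h2
  have h3 : ∑ k ∈ ({i, i + 1} : Finset ℕ), |log (p.1 - (k : ℝ) / n)| ≤
      ∑ k ∈ Finset.range (n + 1), |log (p.1 - (k : ℝ) / n)| := by
    refine Finset.sum_le_sum_of_subset_of_nonneg ?_ fun _ _ _ => abs_nonneg _
    intro k hk
    simp only [Finset.mem_insert, Finset.mem_singleton] at hk
    rw [Finset.mem_range]; omega
  rw [Finset.sum_pair (by omega)] at h3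
  have := neg_abs_le (log (p.2 - p.1))
  have := neg_abs_le (log (p.1 - (i : ℝ) / n))
  have := neg_abs_le (log (p.1 - ((i + 1 : ℕ) : ℝ) / n))
  linarith

lemma integrableOn_log_fst_sub (a : ℝ) :
    IntegrableOn (fun p : ℝ × ℝ => log (p.1 - a)) Delta2 := by
  have h1 : IntegrableOn (fun s : ℝ => log (s - a)) (Set.Icc 0 1) := by
    rw [integrableOn_Icc_iff_integrableOn_Ioc,
      ← intervalIntegrable_iff_integrableOn_Ioc_of_le zero_le_one]
    have := (intervalIntegral.intervalIntegrable_log' (a := 0 - a) (b := 1 - a)).comp_sub_right a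
    simpa using this
  have h2 : IntegrableOn (fun p : ℝ × ℝ => log (p.1 - a)) (Set.Icc 0 1 ×ˢ Set.Icc 0 1) := by
    rw [IntegrableOn, Measure.volume_eq_prod, ← Measure.prod_restrict]
    exact h1.integrable.comp_fst _
  exact h2.mono_set Delta2_subset

lemma integrableOn_log_sigma2 (hn : 1 ≤ n) {u : EuclideanSpace ℝ (Fin d)} (hu : u ≠ 0) :
    IntegrableOn (fun p : ℝ × ℝ => log (sigma2 n p.1 p.2) * gaussD d (p.2 - p.1) u) Delta2 := by
  obtain ⟨C, hC, hb⟩ := gaussD_le_mul d hu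
  have hm : Measurable fun p : ℝ × ℝ => log (sigma2 n p.1 p.2) * gaussD d (p.2 - p.1) u :=
    measurable_sigma2.log.mul
      ((measurable_gaussD d).comp ((measurable_snd.sub measurable_fst).prodMk measurable_const))
  have hdom : IntegrableOn (fun p : ℝ × ℝ => |log (p.2 - p.1) * gaussD d (p.2 - p.1) u| +
      (∑ k ∈ Finset.range (n + 1), |log (p.1 - (k : ℝ) / n)|) * C) Delta2 :=
    (integrableOn_log_gaussD d hu).abs.add
      ((integrable_finsetSum _ fun k _ => (integrableOn_log_fst_sub _).abs).mul_const C)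
  refine Integrable.mono' hdom hm.aestronglyMeasurable ?_
  filter_upwards [ae_restrict_mem measurableSet_Delta2, ae_fst_ne n] with p hp hne
  have h0 : 0 < p.2 - p.1 := sub_pos.2 hp.2.1
  have h1 : p.2 - p.1 ≤ 1 := by linarith [hp.1, hp.2.2]
  have hg := gaussD_pos h0 u
  have hg' : gaussD d (p.2 - p.1) u ≤ C := (hb _ h0 h1).trans (by nlinarith)
  rw [Real.norm_eq_abs, abs_mul, abs_mul, abs_of_pos hg]
  calc _ ≤ (|log (p.2 - p.1)| + ∑ k ∈ Finset.range (n + 1), |log (p.1 - (k : ℝ) / n)|) *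
        gaussD d (p.2 - p.1) u := by
        gcongr; exact (sigma2_pos_and_log_bound hn hp hne).2
    _ ≤ _ := by
        rw [add_mul]
        gcongr

lemma integrableOn_entropy_gaussD (d : ℕ) {u : EuclideanSpace ℝ (Fin d)} (hu : u ≠ 0) :
    IntegrableOn (fun p : ℝ × ℝ =>
      (d * log (p.2 - p.1) + ‖u‖ ^ 2 / (p.2 - p.1)) * gaussD d (p.2 - p.1) u) Delta2 := by
  have := ((integrableOn_log_gaussD d hu).const_mul (d : ℝ)).add
    (integrableOn_inv_gaussD d hu (‖u‖ ^ 2))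
  refine this.congr (Filter.Eventually.of_forall fun p => ?_)
  simp only [Pi.add_apply]
  ring

/-- Jensen inequality for the mixing weights. -/
lemma entropy_weight_le (d : ℕ) {u : EuclideanSpace ℝ (Fin d)} (hu : u ≠ 0) :
    ∫ p in Delta2, (d * log (p.2 - p.1) + ‖u‖ ^ 2 / (p.2 - p.1)) * gaussD d (p.2 - p.1) u ≤
      mUD d u * (-2 * log (2 * mUD d u * (2 * π) ^ ((d : ℝ) / 2))) := by
  have hπ := pi_pos
  have hm := mUD_pos d hu
  set m := mUD d u with hmdef
  have hi1 := integrableOn_gaussD d hu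
  have hInt := integrableOn_entropy_gaussD d hu
  have hle : ∫ p in Delta2, (d * log (p.2 - p.1) + ‖u‖ ^ 2 / (p.2 - p.1)) * gaussD d (p.2 - p.1) u ≤
      ∫ p in Delta2, ((-2 * log (2 * m * (2 * π) ^ ((d : ℝ) / 2)) - 2) * gaussD d (p.2 - p.1) u
        + 4 * m) := by
    refine setIntegral_mono_on hInt ((hi1.const_mul _).add (integrable_const _))
      measurableSet_Delta2 fun p hp => ?_
    have h0 : 0 < p.2 - p.1 := sub_pos.2 hp.2.1
    generalize p.2 - p.1 = τ at *
    have hg := gaussD_pos h0 u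
    have hlog : log (gaussD d τ u) = -(d / 2) * log (2 * π) - (d / 2) * log τ - ‖u‖ ^ 2 / (2 * τ) := by
      unfold gaussD
      rw [log_mul (by positivity) (exp_pos _).ne', log_exp, log_rpow (by positivity),
        log_mul (by positivity) h0.ne']
      ring
    have h1 := log_le_sub_one_of_pos (show 0 < 2 * m / gaussD d τ u by positivity)
    rw [log_div (by positivity) hg.ne', hlog] at h1
    rw [log_mul (by positivity) (by positivity), log_rpow (by positivity)]
    have h2 : (log (2 * m) - (-(d / 2) * log (2 * π) - (d / 2) * log τ - ‖u‖ ^ 2 / (2 * τ)))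
        * gaussD d τ u ≤ 2 * m - gaussD d τ u := by
      have := mul_le_mul_of_nonneg_right h1 hg.le
      have e' : (2 * m / gaussD d τ u - 1) * gaussD d τ u = 2 * m - gaussD d τ u := by field_simp
      rwa [e'] at this
    have e : ‖u‖ ^ 2 / (2 * τ) = ‖u‖ ^ 2 / τ / 2 := by ring
    rw [e] at h2
    nlinarith
  refine hle.trans (le_of_eq ?_)
  rw [integral_add (hi1.const_mul _) (integrable_const _), integral_const_mul]
  change _ * mUD d u + _ = _
  rw [← hmdef]
  simp only [integral_const, smul_eq_mul, Measure.real, Measure.restrict_apply_univ, volume_Delta2]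
  rw [ENNReal.toReal_ofReal (by norm_num)]
  ring

/-- The variance `n ∑_j α_j(s,t)²` of the observed part of the increment over `[s,t]`. -/
noncomputable def obsVar (n : ℕ) (p : ℝ × ℝ) : ℝ := n * ∑ j : Fin n, alphaJ n p.1 p.2 j ^ 2

lemma sigma2_add_obsVar (n : ℕ) (p : ℝ × ℝ) :
    sigma2 n p.1 p.2 + obsVar n p = p.2 - p.1 := by
  unfold sigma2 obsVar; ring

/-- The regression coefficients of `W(t_j)` on the observed part of the increment over `[s,t]`. -/
noncomputable def regCoef (n : ℕ) (p : ℝ × ℝ) (j : Fin n) : ℝ :=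
  (max p.1 (min p.2 (((j : ℝ) + 1) / n)) - p.1) / obsVar n p

lemma padDiff_regCoef_smul {p : ℝ × ℝ} (hp : p ∈ Delta2) (w : EuclideanSpace ℝ (Fin d))
    (j : Fin n) :
    padDiff (fun i => regCoef n p i • w) j = (alphaJ n p.1 p.2 j / obsVar n p) • w := by
  rw [alphaJ_eq n hp.2.1.le]
  cases n with
  | zero => exact j.elim0
  | succ k =>
    unfold padDiff
    rw [Fin.cons_succ]
    induction j using Fin.cases with
    | zero =>
      have : min p.2 0 ≤ p.1 := (min_le_right _ _).trans hp.1
      simp [regCoef, this]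
    | succ i =>
      rw [← Fin.succ_castSucc, Fin.cons_succ, ← sub_smul]
      congr 1
      simp only [regCoef, Fin.val_castSucc, Fin.val_succ]
      push_cast
      ring

lemma sum_regCoef_sq_le (hn : 1 ≤ n) {p : ℝ × ℝ} (hp : p ∈ Delta2) :
    2 * n * (1 - cos (π / (2 * n + 1))) * ∑ j, regCoef n p j ^ 2 ≤ 1 / obsVar n p := by
  have hn' : (0 : ℝ) < n := by exact_mod_cast hn
  have hv : 0 < obsVar n p := sum_alphaJ_sq_pos hn hp
  have h := discrete_wirtinger n
    (fun k => (max p.1 (min p.2 ((k : ℝ) / n)) - p.1) / obsVar n p) (by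
      have : min p.2 0 ≤ p.1 := (min_le_right _ _).trans hp.1
      simp [this])
  rw [← Fin.sum_univ_eq_sum_range
      (fun j => ((max p.1 (min p.2 (((j + 1 : ℕ) : ℝ) / n)) - p.1) / obsVar n p) ^ 2),
    ← Fin.sum_univ_eq_sum_range
      (fun j => ((max p.1 (min p.2 (((j + 1 : ℕ) : ℝ) / n)) - p.1) / obsVar n p -
        (max p.1 (min p.2 ((j : ℝ) / n)) - p.1) / obsVar n p) ^ 2)] at h
  have e : ∑ j : Fin n, ((max p.1 (min p.2 (((j + 1 : ℕ) : ℝ) / n)) - p.1) / obsVar n p -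
        (max p.1 (min p.2 ((j : ℝ) / n)) - p.1) / obsVar n p) ^ 2 = 1 / (n * obsVar n p) := by
    have : ∀ j : Fin n, ((max p.1 (min p.2 (((j + 1 : ℕ) : ℝ) / n)) - p.1) / obsVar n p -
        (max p.1 (min p.2 ((j : ℝ) / n)) - p.1) / obsVar n p) ^ 2 =
        alphaJ n p.1 p.2 j ^ 2 * (obsVar n p ^ 2)⁻¹ := by
      intro j
      rw [alphaJ_eq n hp.2.1.le]
      push_cast
      ring
    rw [Finset.sum_congr rfl fun j _ => this j, ← Finset.sum_mul]
    have e2 : ∑ j : Fin n, alphaJ n p.1 p.2 j ^ 2 = obsVar n p / n := by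
      unfold obsVar; field_simp
    rw [e2]
    field_simp
  rw [e] at h
  have h' := mul_le_mul_of_nonneg_left h hn'.le
  have e3 : (n : ℝ) * (1 / (n * obsVar n p)) = 1 / obsVar n p := by field_simp
  rw [e3] at h'
  refine le_trans (le_of_eq ?_) h'
  simp only [regCoef]
  push_cast
  ring

/-- The transport map from `μ_n` to its conditional law given that the increment over `[s,t]`
equals `u`. -/
noncomputable def bridgeMap (n : ℕ) (u : EuclideanSpace ℝ (Fin d)) (p : ℝ × ℝ)
    (x : Fin n → EuclideanSpace ℝ (Fin d)) : Fin n → EuclideanSpace ℝ (Fin d) :=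
  postMap (alphaJ n p.1 p.2) (regCoef n p) (sigma2 n p.1 p.2) (obsVar n p) u x

lemma measurable_obsLM_alphaJ : Measurable fun z : (ℝ × ℝ) × (Fin n → EuclideanSpace ℝ (Fin d)) =>
    obsLM (alphaJ n z.1.1 z.1.2) z.2 := by
  simp_rw [obsLM_apply]
  refine (Finset.measurable_sum _ fun j _ => ?_).const_smul (n : ℝ)
  exact ((measurable_alphaJ j).comp measurable_fst).smul
    (((continuous_apply j).comp (continuous_padDiff n d)).measurable.comp measurable_snd)

lemma measurable_obsVar : Measurable (obsVar n) :=
  (Finset.measurable_sum _ fun j _ => (measurable_alphaJ j).pow_const 2).const_mul _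

lemma measurable_bridgeMap (u : EuclideanSpace ℝ (Fin d)) :
    Measurable fun z : (ℝ × ℝ) × (Fin n → EuclideanSpace ℝ (Fin d)) => bridgeMap n u z.1 z.2 := by
  refine measurable_pi_lambda _ fun j => ?_
  unfold bridgeMap postMap
  have h1 : Measurable fun z : (ℝ × ℝ) × (Fin n → EuclideanSpace ℝ (Fin d)) => obsVar n z.1 :=
    measurable_obsVar.comp measurable_fst
  have h2 : Measurable fun z : (ℝ × ℝ) × (Fin n → EuclideanSpace ℝ (Fin d)) =>
      sigma2 n z.1.1 z.1.2 := measurable_sigma2.comp measurable_fst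
  have h3 := measurable_obsLM_alphaJ (n := n) (d := d)
  have h4 : Measurable fun z : (ℝ × ℝ) × (Fin n → EuclideanSpace ℝ (Fin d)) => regCoef n z.1 j := by
    unfold regCoef; fun_prop
  fun_prop

lemma map_bridgeMap (hn : 1 ≤ n) (u : EuclideanSpace ℝ (Fin d)) {p : ℝ × ℝ} (hp : p ∈ Delta2)
    (hs : 0 < sigma2 n p.1 p.2) :
    (muN d n).map (bridgeMap n u p) = (muN d n).withDensity fun x => ENNReal.ofReal
      (gaussD d (sigma2 n p.1 p.2) (obsLM (alphaJ n p.1 p.2) x - u) / gaussD d (p.2 - p.1) u) := by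
  rw [← sigma2_add_obsVar n p]
  exact map_postMap hn hs (sum_alphaJ_sq_pos hn hp) rfl (padDiff_regCoef_smul hp) u

lemma cos_factor_pos (hn : 1 ≤ n) : 0 < 2 * (n : ℝ) * (1 - cos (π / (2 * n + 1))) := by
  have hn' : (1 : ℝ) ≤ n := by exact_mod_cast hn
  have hπ := pi_pos
  have : cos (π / (2 * n + 1)) < cos 0 := by
    apply cos_lt_cos_of_nonneg_of_le_pi le_rfl _ (by positivity)
    rw [div_le_iff₀ (by positivity)]
    nlinarith
  rw [cos_zero] at this
  have : 0 < 1 - cos (π / (2 * n + 1)) := by linarith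
  positivity

lemma lintegral_bridgeMap_cost_le (hn : 1 ≤ n) (u : EuclideanSpace ℝ (Fin d)) {p : ℝ × ℝ}
    (hp : p ∈ Delta2) (hs : 0 < sigma2 n p.1 p.2) :
    ∫⁻ x, ENNReal.ofReal (∑ j, ‖bridgeMap n u p x j - x j‖ ^ 2) ∂(muN d n) ≤
      ENNReal.ofReal ((2 * n * (1 - cos (π / (2 * n + 1))))⁻¹ *
        (d * log (p.2 - p.1) + ‖u‖ ^ 2 / (p.2 - p.1) - d * log (sigma2 n p.1 p.2))) := by
  have hv : 0 < obsVar n p := sum_alphaJ_sq_pos hn hp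
  have hτ := sigma2_add_obsVar n p
  have hK := cos_factor_pos hn
  have hC := sum_regCoef_sq_le hn hp
  set K := 2 * (n : ℝ) * (1 - cos (π / (2 * n + 1)))
  set v := obsVar n p with hvdef
  set s := sigma2 n p.1 p.2
  rw [← hτ]
  have hC0 : 0 ≤ ∑ j, regCoef n p j ^ 2 := by positivity
  have hpt : ∀ x : Fin n → EuclideanSpace ℝ (Fin d), ENNReal.ofReal
      (∑ j, ‖bridgeMap n u p x j - x j‖ ^ 2) = ENNReal.ofReal (∑ j, regCoef n p j ^ 2) *
      ENNReal.ofReal (‖(v / (s + v)) • u + (√(s / (s + v)) - 1) • obsLM (alphaJ n p.1 p.2) x‖ ^ 2) := by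
    intro x
    rw [← ENNReal.ofReal_mul hC0, Finset.sum_mul]
    congr 1
    refine Finset.sum_congr rfl fun j _ => ?_
    simp only [bridgeMap, postMap, add_sub_cancel_left]
    rw [norm_smul, mul_pow, Real.norm_eq_abs, sq_abs]
  simp_rw [hpt]
  rw [lintegral_const_mul' _ _ ENNReal.ofReal_ne_top]
  refine (mul_le_mul_right (lintegral_sq_norm_affine_le hn hv rfl (padDiff_regCoef_smul hp)
    _ _ u) _).trans ?_
  rw [← ENNReal.ofReal_mul hC0]
  apply ENNReal.ofReal_le_ofReal
  have hr := one_sub_sqrt_sq_le_neg_log (r := s / (s + v)) (by positivity)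
    ((div_le_one (by positivity)).2 (by linarith))
  rw [log_div (by positivity) (by positivity)] at hr
  have hC' : ∑ j, regCoef n p j ^ 2 ≤ K⁻¹ * (1 / v) := by
    rw [← div_eq_inv_mul, le_div_iff₀ hK]; linarith
  calc _ ≤ K⁻¹ * (1 / v) * ((v / (s + v)) ^ 2 * ‖u‖ ^ 2 + (√(s / (s + v)) - 1) ^ 2 * (d * v)) := by
        gcongr
    _ = K⁻¹ * (v / (s + v) * (‖u‖ ^ 2 / (s + v)) + d * (1 - √(s / (s + v))) ^ 2) := by
        field_simp
        ring
    _ ≤ K⁻¹ * (1 * (‖u‖ ^ 2 / (s + v)) + d * -(log s - log (s + v))) := by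
        gcongr
        exact (div_le_one (by positivity)).2 (by linarith)
    _ = _ := by ring

/-- The law on `Δ₂` with density proportional to `p^d_{t-s}(u)`. -/
noncomputable def mixingLaw (d : ℕ) (u : EuclideanSpace ℝ (Fin d)) : Measure (ℝ × ℝ) :=
  (volume.restrict Delta2).withDensity
    fun p => ENNReal.ofReal (gaussD d (p.2 - p.1) u / mUD d u)

lemma measurable_mixingDensity (u : EuclideanSpace ℝ (Fin d)) :
    Measurable fun p : ℝ × ℝ => ENNReal.ofReal (gaussD d (p.2 - p.1) u / mUD d u) :=
  (((measurable_gaussD d).comp ((measurable_snd.sub measurable_fst).prodMk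
    measurable_const)).div_const _).ennreal_ofReal

lemma isProbabilityMeasure_mixingLaw {u : EuclideanSpace ℝ (Fin d)} (hu : u ≠ 0) :
    IsProbabilityMeasure (mixingLaw d u) := by
  have hm := mUD_pos d hu
  constructor
  rw [mixingLaw, withDensity_apply _ MeasurableSet.univ, Measure.restrict_univ,
    ← ofReal_integral_eq_lintegral_ofReal ((integrableOn_gaussD d hu).div_const _)]
  · rw [integral_div]
    change ENNReal.ofReal (mUD d u / mUD d u) = 1
    rw [div_self hm.ne', ENNReal.ofReal_one]
  · filter_upwards [ae_restrict_mem measurableSet_Delta2] with p hp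
    exact div_nonneg (gaussD_pos (sub_pos.2 hp.2.1) u).le hm.le

lemma ae_sigma2_pos (hn : 1 ≤ n) :
    ∀ᵐ p : ℝ × ℝ ∂(volume.restrict Delta2), p ∈ Delta2 ∧ 0 < sigma2 n p.1 p.2 := by
  filter_upwards [ae_restrict_mem measurableSet_Delta2, ae_fst_ne n] with p hp hne
  exact ⟨hp, (sigma2_pos_and_log_bound hn hp hne).1⟩

/-- The coupling of the mixture of the conditional laws with `μ_n`. -/
noncomputable def bridgeCoupling (n : ℕ) (u : EuclideanSpace ℝ (Fin d)) :
    Measure ((Fin n → EuclideanSpace ℝ (Fin d)) × (Fin n → EuclideanSpace ℝ (Fin d))) :=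
  ((mixingLaw d u).prod (muN d n)).map fun z => (bridgeMap n u z.1 z.2, z.2)

lemma lintegral_bridgeCoupling (hn : 1 ≤ n) (u : EuclideanSpace ℝ (Fin d))
    {f : (Fin n → EuclideanSpace ℝ (Fin d)) × (Fin n → EuclideanSpace ℝ (Fin d)) → ENNReal}
    (hf : Measurable f) :
    ∫⁻ y, f y ∂(bridgeCoupling n u) =
      ∫⁻ p in Delta2, ENNReal.ofReal (gaussD d (p.2 - p.1) u / mUD d u) *
        ∫⁻ x, f (bridgeMap n u p x, x) ∂(muN d n) := by
  have := isProbabilityMeasure_muN d hn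
  have hT := (measurable_bridgeMap (n := n) u).prodMk measurable_snd
  have hfT : Measurable fun z : (ℝ × ℝ) × (Fin n → EuclideanSpace ℝ (Fin d)) =>
    f (bridgeMap n u z.1 z.2, z.2) := hf.comp hT
  rw [bridgeCoupling, lintegral_map hf hT, lintegral_prod _ hfT.aemeasurable, mixingLaw,
    lintegral_withDensity_eq_lintegral_mul _ (measurable_mixingDensity u) hfT.lintegral_prod_right']
  rfl

lemma map_snd_bridgeCoupling (hn : 1 ≤ n) {u : EuclideanSpace ℝ (Fin d)} (hu : u ≠ 0) :
    (bridgeCoupling n u).map Prod.snd = muN d n := by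
  have := isProbabilityMeasure_muN d hn
  have := isProbabilityMeasure_mixingLaw hu
  rw [bridgeCoupling, Measure.map_map measurable_snd
    ((measurable_bridgeMap (n := n) u).prodMk measurable_snd)]
  exact measurePreserving_snd.map_eq

lemma map_fst_bridgeCoupling (hn : 1 ≤ n) {u : EuclideanSpace ℝ (Fin d)} (hu : u ≠ 0) :
    (bridgeCoupling n u).map Prod.fst = thetaTilde d n u := by
  have hprob := isProbabilityMeasure_muN d hn
  have hprob' := isProbabilityMeasure_mixingLaw hu
  have hm := mUD_pos d hu
  set F : (ℝ × ℝ) → (Fin n → EuclideanSpace ℝ (Fin d)) → ℝ := fun p x =>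
    gaussD d (sigma2 n p.1 p.2) (obsLM (alphaJ n p.1 p.2) x - u) / mUD d u with hF
  have hFm : Measurable (Function.uncurry F) :=
    ((measurable_gaussD d).comp ((measurable_sigma2.comp measurable_fst).prodMk
      (measurable_obsLM_alphaJ.sub_const u))).div_const _
  have hF0 : ∀ x, 0 ≤ᵐ[volume.restrict Delta2] fun p => F p x := by
    intro x
    filter_upwards [ae_sigma2_pos hn] with p hp
    exact div_nonneg (gaussD_pos hp.2 _).le hm.le
  have key : ∀ A : Set (Fin n → EuclideanSpace ℝ (Fin d)), MeasurableSet A →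
      (bridgeCoupling n u).map Prod.fst A =
        ∫⁻ x in A, (∫⁻ p in Delta2, ENNReal.ofReal (F p x)) ∂(muN d n) := by
    intro A hA
    rw [Measure.map_apply measurable_fst hA,
      ← lintegral_indicator_one (measurable_fst hA), lintegral_bridgeCoupling hn u
        (measurable_one.indicator (measurable_fst hA)),
      lintegral_lintegral_swap hFm.ennreal_ofReal.aemeasurable.prod_swap]
    refine lintegral_congr_ae ?_
    filter_upwards [ae_sigma2_pos hn] with p hp
    have hg := gaussD_pos (sub_pos.2 hp.1.2.1) u
    have hTm : Measurable (bridgeMap n u p) := measurable_postMap _ _ _ _ _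
    have e : ∫⁻ x, (Prod.fst ⁻¹' A).indicator 1 (bridgeMap n u p x, x) ∂(muN d n) =
        (muN d n).map (bridgeMap n u p) A := by
      rw [Measure.map_apply hTm hA, ← lintegral_indicator_one (hTm hA)]
      rfl
    rw [e, map_bridgeMap hn u hp.1 hp.2, withDensity_apply _ hA,
      ← lintegral_const_mul' _ _ ENNReal.ofReal_ne_top]
    refine lintegral_congr fun x => ?_
    rw [← ENNReal.ofReal_mul (by positivity)]
    congr 1
    simp only [hF]
    field_simp
  have hmeas : Measurable fun x => ∫⁻ p in Delta2, ENNReal.ofReal (F p x) :=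
    hFm.ennreal_ofReal.lintegral_prod_left'
  have hfin : ∀ᵐ x ∂(muN d n), ∫⁻ p in Delta2, ENNReal.ofReal (F p x) < ⊤ := by
    refine ae_lt_top hmeas ?_
    have := key Set.univ MeasurableSet.univ
    rw [Measure.restrict_univ] at this
    rw [← this]
    have hc : IsProbabilityMeasure (bridgeCoupling n u) := by
      unfold bridgeCoupling
      exact Measure.isProbabilityMeasure_map
        ((measurable_bridgeMap (n := n) u).prodMk measurable_snd).aemeasurable
    rw [Measure.map_apply measurable_fst MeasurableSet.univ]
    exact measure_ne_top _ _
  ext A hA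
  rw [key A hA, thetaTilde, withDensity_apply _ hA]
  refine lintegral_congr_ae (ae_restrict_of_ae ?_)
  filter_upwards [hfin] with x hx
  have hInt : IntegrableOn (fun p => F p x) Delta2 := by
    refine ⟨(hFm.comp (measurable_id.prodMk measurable_const)).aestronglyMeasurable, ?_⟩
    rwa [hasFiniteIntegral_iff_ofReal (hF0 x)]
  rw [← ofReal_integral_eq_lintegral_ofReal hInt (hF0 x)]
  simp only [hF, integral_div, obsLM_apply, qUN]

lemma integral_bridgeCoupling_le (hn : 1 ≤ n) {u : EuclideanSpace ℝ (Fin d)} (hu : u ≠ 0) :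
    ∫ y, (∑ j : Fin n, ‖y.1 j - y.2 j‖ ^ 2) ∂(bridgeCoupling n u) ≤
      (2 / (2 * n * (1 - cos (π / (2 * n + 1))))) *
        (-log (2 * mUD d u * (2 * π) ^ ((d : ℝ) / 2)) - (d / (2 * mUD d u)) *
          ∫ p in Delta2, log (sigma2 n p.1 p.2) * gaussD d (p.2 - p.1) u) := by
  have hm := mUD_pos d hu
  have hK := cos_factor_pos hn
  set K := 2 * (n : ℝ) * (1 - cos (π / (2 * n + 1))) with hKdef
  have hcm : Measurable fun y : (Fin n → EuclideanSpace ℝ (Fin d)) ×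
      (Fin n → EuclideanSpace ℝ (Fin d)) => ∑ j : Fin n, ‖y.1 j - y.2 j‖ ^ 2 := by
    have : Continuous fun y : (Fin n → EuclideanSpace ℝ (Fin d)) ×
      (Fin n → EuclideanSpace ℝ (Fin d)) => ∑ j : Fin n, ‖y.1 j - y.2 j‖ ^ 2 := by fun_prop
    exact this.measurable
  have hi1 := integrableOn_entropy_gaussD d hu
  have hi2 := (integrableOn_log_sigma2 (d := d) hn hu).const_mul (d : ℝ)
  set H : ℝ × ℝ → ℝ := fun p => (d * log (p.2 - p.1) + ‖u‖ ^ 2 / (p.2 - p.1)) *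
    gaussD d (p.2 - p.1) u - d * (log (sigma2 n p.1 p.2) * gaussD d (p.2 - p.1) u) with hH
  have hHi : IntegrableOn H Delta2 := hi1.sub hi2
  have hHle : ∫ p in Delta2, H p ≤ mUD d u * (-2 * log (2 * mUD d u * (2 * π) ^ ((d : ℝ) / 2))) -
      d * ∫ p in Delta2, log (sigma2 n p.1 p.2) * gaussD d (p.2 - p.1) u := by
    rw [hH, integral_sub hi1 hi2, integral_const_mul]
    exact sub_le_sub_right (entropy_weight_le d hu) _
  have hH0 : 0 ≤ᵐ[volume.restrict Delta2] fun p => (K * mUD d u)⁻¹ * H p := by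
    filter_upwards [ae_sigma2_pos hn] with p hp
    have hτ : 0 < p.2 - p.1 := sub_pos.2 hp.1.2.1
    have hg := gaussD_pos hτ u
    have hlog := log_le_log hp.2 (sigma2_le p)
    have e : H p = (d * (log (p.2 - p.1) - log (sigma2 n p.1 p.2)) + ‖u‖ ^ 2 / (p.2 - p.1)) *
        gaussD d (p.2 - p.1) u := by simp only [hH]; ring
    have : 0 ≤ log (p.2 - p.1) - log (sigma2 n p.1 p.2) := sub_nonneg.2 hlog
    rw [e]
    simp only [Pi.zero_apply]
    positivity
  have hcost : ∫⁻ y, ENNReal.ofReal (∑ j : Fin n, ‖y.1 j - y.2 j‖ ^ 2) ∂(bridgeCoupling n u) ≤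
      ENNReal.ofReal (∫ p in Delta2, (K * mUD d u)⁻¹ * H p) := by
    rw [lintegral_bridgeCoupling hn u hcm.ennreal_ofReal,
      ofReal_integral_eq_lintegral_ofReal (hHi.const_mul _) hH0]
    refine lintegral_mono_ae ?_
    filter_upwards [ae_sigma2_pos hn] with p hp
    have hg := gaussD_pos (sub_pos.2 hp.1.2.1) u
    refine (mul_le_mul_right (lintegral_bridgeMap_cost_le hn u hp.1 hp.2) _).trans (le_of_eq ?_)
    rw [← ENNReal.ofReal_mul (by positivity)]
    congr 1
    simp only [hH, ← hKdef]
    field_simp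
  rw [integral_eq_lintegral_of_nonneg_ae (Filter.Eventually.of_forall fun y => by positivity)
    hcm.aestronglyMeasurable]
  refine (ENNReal.toReal_mono ENNReal.ofReal_ne_top hcost).trans ?_
  rw [ENNReal.toReal_ofReal (integral_nonneg_of_ae hH0), integral_const_mul]
  refine (mul_le_mul_of_nonneg_left hHle (by positivity)).trans (le_of_eq ?_)
  field_simp

end

theorem stmt17 (d n : ℕ) (hd : 4 ≤ d) (hn : 1 ≤ n)
    (u : EuclideanSpace ℝ (Fin d)) (hu : u ≠ 0) :
    ∃ ν : Measure ((Fin n → EuclideanSpace ℝ (Fin d)) × (Fin n → EuclideanSpace ℝ (Fin d))),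
      IsProbabilityMeasure ν ∧
      ν.map Prod.fst = thetaTilde d n u ∧
      ν.map Prod.snd = muN d n ∧
      (∫ p, (∑ j : Fin n, ‖p.1 j - p.2 j‖ ^ 2) ∂ν)
        ≤ (2 / (2 * n * (1 - Real.cos (Real.pi / (2 * n + 1))))) *
            (-Real.log (2 * mUD d u * (2 * Real.pi) ^ ((d : ℝ) / 2))
              - (d / (2 * mUD d u)) *
                ∫ p in Delta2, Real.log (sigma2 n p.1 p.2) * gaussD d (p.2 - p.1) u) := by
  have := isProbabilityMeasure_muN d hn
  have := isProbabilityMeasure_mixingLaw hu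
  exact ⟨bridgeCoupling n u, Measure.isProbabilityMeasure_map
    ((measurable_bridgeMap (n := n) u).prodMk measurable_snd).aemeasurable,
    map_fst_bridgeCoupling hn hu, map_snd_bridgeCoupling hn hu, integral_bridgeCoupling_le hn hu⟩
end

section
/- Let d ≥ 4 and define m(u,d) = ∫_{Δ₂} p^d_{t−s}(u) ds dt for u ∈ ℝ^d, u ≠ 0. Then, as u → 0, m(u,d) is asymptotically equivalent to c(d)/‖u‖^{d−2} with the explicit constant c(d) = Γ(d/2 − 1)/(2 π^{d/2}); that is, lim_{u→0} ‖u‖^{d−2} m(u,d) = Γ(d/2 − 1)/(2 π^{d/2}). -/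
open MeasureTheory Real Filter

/-- Integrating a function of `t - s` over the simplex reduces to a one-dimensional integral. -/
lemma setIntegral_Delta2_comp_sub {F : ℝ → ℝ} (hF : IntegrableOn F (Set.Ioi 0)) :
    ∫ p in Delta2, F (p.2 - p.1) = ∫ r in Set.Ioi 0, max (1 - r) 0 * F r := by
  set E : Set (ℝ × ℝ) := {p | 0 ≤ p.1 ∧ 0 < p.2 ∧ p.1 + p.2 ≤ 1} with hE
  have hEm : MeasurableSet E := by
    apply MeasurableSet.inter (measurableSet_le measurable_const measurable_fst)
    exact (measurableSet_lt measurable_const measurable_snd).inter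
      (measurableSet_le (measurable_fst.add measurable_snd) measurable_const)
  have hpre : (MeasurableEquiv.shearAddRight ℝ) ⁻¹' Delta2 = E := by
    ext p
    simp [Delta2, hE, MeasurableEquiv.shearAddRight]
  have hshear : ∫ p in Delta2, F (p.2 - p.1) = ∫ p in E, F p.2 := by
    have h := (measurePreserving_prod_add (volume : Measure ℝ)
      (volume : Measure ℝ)).setIntegral_preimage_emb
      (MeasurableEquiv.shearAddRight ℝ).measurableEmbedding
      (fun p : ℝ × ℝ => F (p.2 - p.1)) Delta2
    rw [← Measure.volume_eq_prod] at h
    rw [← h, ← hpre]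
    simp [MeasurableEquiv.shearAddRight]
  have hint : IntegrableOn (fun p : ℝ × ℝ => F p.2) E := by
    have h : IntegrableOn (fun p : ℝ × ℝ => F p.2) (Set.Icc 0 1 ×ˢ Set.Ioi 0) := by
      rw [IntegrableOn, Measure.volume_eq_prod, ← Measure.prod_restrict]
      exact Integrable.comp_snd hF _
    refine h.mono_set fun p hp => ⟨⟨hp.1, ?_⟩, hp.2.1⟩
    linarith [hp.2.1, hp.2.2]
  rw [hshear, ← integral_indicator hEm, Measure.volume_eq_prod,
    integral_prod_symm _ (by rw [← Measure.volume_eq_prod]; exact hint.integrable_indicator hEm),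
    ← integral_indicator measurableSet_Ioi]
  refine integral_congr_ae (ae_of_all _ fun r => ?_)
  by_cases hr : 0 < r
  · have h : (fun s => E.indicator (fun p : ℝ × ℝ => F p.2) (s, r)) =
        (Set.Icc 0 (1 - r)).indicator fun _ => F r := by
      ext s
      simp [Set.indicator, hE, hr, le_sub_iff_add_le]
    simp [h, hr, integral_indicator, Real.volume_real_Icc]
  · simp [Set.indicator, hE, hr]

/-- The substitution `x ↦ x⁻¹` turns the time integral of the Gaussian density at distance one
into a Gamma integral. -/
lemma integrableOn_and_integral_rpow_mul_exp_inv {a : ℝ} (ha : 1 < a) :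
    IntegrableOn (fun x : ℝ => (2 * π * x) ^ (-a) * exp (-1 / (2 * x))) (Set.Ioi 0) ∧
    ∫ x in Set.Ioi (0 : ℝ), (2 * π * x) ^ (-a) * exp (-1 / (2 * x)) =
      Gamma (a - 1) / (2 * π ^ a) := by
  set G : ℝ → ℝ := fun y => (2 * π) ^ (-a) * (y ^ (a - 1 - 1) * exp (-((1 / 2) * y))) with hG
  have hcomp : ∀ x ∈ Set.Ioi (0 : ℝ),
      (|(-1 : ℝ)| * x ^ ((-1 : ℝ) - 1)) • G (x ^ (-1 : ℝ)) =
        (2 * π * x) ^ (-a) * exp (-1 / (2 * x)) := by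
    intro x (hx : 0 < x)
    have hpow : x ^ ((-1 : ℝ) - 1) * (x ^ (-1 : ℝ)) ^ (a - 1 - 1) = x ^ (-a) := by
      rw [← rpow_mul hx.le, ← rpow_add hx]
      congr 1
      ring
    have hexp : -(1 / 2 * x ^ (-1 : ℝ)) = -1 / (2 * x) := by
      rw [rpow_neg_one]
      field_simp
    simp only [hG, smul_eq_mul, hexp, abs_neg, abs_one, one_mul]
    rw [mul_rpow (by positivity) hx.le, ← hpow]
    ring
  have hGint : IntegrableOn G (Set.Ioi 0) := by
    have h := integrableOn_rpow_mul_exp_neg_mul_rpow (s := a - 1 - 1) (p := 1) (b := 1 / 2)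
      (by linarith) one_pos (by norm_num)
    simp only [rpow_one, neg_mul] at h
    exact h.const_mul _
  refine ⟨?_, ?_⟩
  · exact ((integrableOn_Ioi_comp_rpow_iff G (by norm_num : (-1 : ℝ) ≠ 0)).2 hGint).congr_fun
      hcomp measurableSet_Ioi
  · rw [← setIntegral_congr_fun measurableSet_Ioi hcomp, integral_comp_rpow_Ioi G (by norm_num),
      hG, integral_const_mul, integral_rpow_mul_exp_neg_mul_Ioi (by linarith) (by norm_num),
      mul_rpow (by norm_num) pi_pos.le, rpow_neg (by norm_num), rpow_neg pi_pos.le,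
      one_div_one_div, rpow_sub_one (by norm_num)]
    field_simp

/-- Brownian scaling of the Gaussian density. -/
lemma gaussD_sq_mul {d : ℕ} {u : EuclideanSpace ℝ (Fin d)} (hu : u ≠ 0) {x : ℝ} (hx : 0 < x) :
    gaussD d (‖u‖ ^ 2 * x) u =
      (‖u‖ ^ d)⁻¹ * ((2 * π * x) ^ (-((d : ℝ) / 2)) * exp (-1 / (2 * x))) := by
  have hn : 0 < ‖u‖ := norm_pos_iff.2 hu
  have hpow : (‖u‖ ^ 2) ^ (-((d : ℝ) / 2)) = (‖u‖ ^ d)⁻¹ := by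
    rw [← rpow_natCast, ← rpow_mul hn.le, ← rpow_natCast ‖u‖ d, ← rpow_neg hn.le]
    congr 1
    push_cast
    ring
  have hexp : -‖u‖ ^ 2 / (2 * (‖u‖ ^ 2 * x)) = -1 / (2 * x) := by
    field_simp
  rw [gaussD, hexp, neg_div, show 2 * π * (‖u‖ ^ 2 * x) = ‖u‖ ^ 2 * (2 * π * x) by ring,
    mul_rpow (by positivity) (by positivity), hpow, mul_assoc]

/-- The normalised simplex integral as a weighted integral with `u`-independent density. -/
lemma norm_pow_mul_setIntegral_gaussD {d : ℕ} (hd : 2 < d) {u : EuclideanSpace ℝ (Fin d)}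
    (hu : u ≠ 0) :
    ‖u‖ ^ (d - 2) * ∫ p in Delta2, gaussD d (p.2 - p.1) u =
      ∫ x in Set.Ioi (0 : ℝ), max (1 - ‖u‖ ^ 2 * x) 0 *
        ((2 * π * x) ^ (-((d : ℝ) / 2)) * exp (-1 / (2 * x))) := by
  have hn : 0 < ‖u‖ := norm_pos_iff.2 hu
  have hd' : (1 : ℝ) < (d : ℝ) / 2 := by
    have : (2 : ℝ) < d := by exact_mod_cast hd
    linarith
  have hint : IntegrableOn (fun r => gaussD d r u) (Set.Ioi 0) := by
    have h := (integrableOn_Ioi_comp_mul_left_iff (fun r => gaussD d r u) 0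
      (pow_pos hn 2)).1
    rw [mul_zero] at h
    exact h (IntegrableOn.congr_fun
      ((integrableOn_and_integral_rpow_mul_exp_inv hd').1.const_mul (‖u‖ ^ d)⁻¹)
      (fun x hx => (gaussD_sq_mul hu hx).symm) measurableSet_Ioi)
  have hscale := integral_comp_mul_left_Ioi (fun r => max (1 - r) 0 * gaussD d r u) 0
    (pow_pos hn 2)
  rw [mul_zero, smul_eq_mul, eq_inv_mul_iff_mul_eq₀ (pow_pos hn 2).ne'] at hscale
  rw [setIntegral_Delta2_comp_sub hint, ← hscale, ← mul_assoc, ← pow_add,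
    Nat.sub_add_cancel hd.le, ← integral_const_mul]
  refine setIntegral_congr_fun measurableSet_Ioi fun x hx => ?_
  simp only [gaussD_sq_mul hu hx]
  field_simp

theorem stmt18 (d : ℕ) (hd : 4 ≤ d) :
    Tendsto
      (fun u : EuclideanSpace ℝ (Fin d) =>
        ‖u‖ ^ (d - 2) * ∫ p in Delta2, gaussD d (p.2 - p.1) u)
      (nhdsWithin 0 {0}ᶜ)
      (nhds (Real.Gamma ((d : ℝ) / 2 - 1) / (2 * Real.pi ^ ((d : ℝ) / 2)))) := by
  have hd' : (1 : ℝ) < (d : ℝ) / 2 := by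
    have : (4 : ℝ) ≤ d := by exact_mod_cast hd
    linarith
  obtain ⟨hint, hval⟩ := integrableOn_and_integral_rpow_mul_exp_inv hd'
  rw [← hval]
  refine Tendsto.congr' (eventually_mem_nhdsWithin.mono fun u hu =>
    (norm_pow_mul_setIntegral_gaussD (by omega) hu).symm) ?_
  refine tendsto_integral_filter_of_dominated_convergence
    (fun x => (2 * π * x) ^ (-((d : ℝ) / 2)) * exp (-1 / (2 * x))) ?_ ?_ hint ?_
  · refine Eventually.of_forall fun u => AEStronglyMeasurable.mul ?_ hint.aestronglyMeasurable
    exact Continuous.aestronglyMeasurable (by fun_prop)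
  · refine Eventually.of_forall fun u =>
      (ae_restrict_mem measurableSet_Ioi).mono fun x (hx : 0 < x) => ?_
    rw [norm_of_nonneg (by positivity)]
    refine mul_le_of_le_one_left (by positivity) (max_le ?_ zero_le_one)
    linarith [mul_nonneg (sq_nonneg ‖u‖) hx.le]
  · refine ae_of_all _ fun x => ?_
    have hcont : Continuous fun u : EuclideanSpace ℝ (Fin d) => max (1 - ‖u‖ ^ 2 * x) 0 *
        ((2 * π * x) ^ (-((d : ℝ) / 2)) * exp (-1 / (2 * x))) := by fun_prop
    simpa using (hcont.tendsto 0).mono_left nhdsWithin_le_nhds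
end
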